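/- Let α > 0 with α ∉ ℕ, and let σ_α = sup_{m ∈ ℕ, m ≥ 2} min( 2^{1−m}, (m−α)/(2^m−1), 2^{1−m}·α ) ∈ (0,1). Then there exists a function f : ℂ → ℂ that is complex-differentiable on the half-plane {s : Re(s) > 1 − σ_α}, satisfies f(s) = Σ_{n≥1} ({n^α} − 1/2)/n^{s} for all s with Re(s) > 1, and such that for every ε > 0 there is C_ε > 0 with |f(s)| ≤ C_ε·(1 + |s|) for all s with Re(s) ≥ 1 − σ_α + ε. -/

import Mathlib

open Filter Topology Real

/-- The additive character `x ↦ exp (2 π i x)`. -/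
noncomputable def addChar (x : ℝ) : ℂ := Complex.exp ((2 * π * x : ℝ) * Complex.I)

theorem norm_addChar (x : ℝ) : ‖addChar x‖ = 1 := Complex.norm_exp_ofReal_mul_I _

theorem addChar_add (x y : ℝ) : addChar (x + y) = addChar x * addChar y := by
  unfold addChar
  rw [← Complex.exp_add]
  push_cast
  ring_nf

theorem addChar_int (j : ℤ) : addChar j = 1 := by
  unfold addChar
  rw [Complex.exp_eq_one_iff]
  exact ⟨j, by push_cast; ring⟩

theorem conj_addChar (x : ℝ) : (starRingEnd ℂ) (addChar x) = addChar (-x) := by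
  unfold addChar
  rw [← Complex.exp_conj, map_mul, Complex.conj_ofReal, Complex.conj_I]
  push_cast
  ring_nf

theorem addChar_eq (x : ℝ) : addChar x = (cos (2 * π * x) : ℝ) + (sin (2 * π * x) : ℝ) * Complex.I := by
  unfold addChar
  rw [Complex.exp_mul_I]
  push_cast
  rfl

theorem sum_range_mul_sub_succ {R : Type*} [CommRing R] (c u : ℕ → R) (N : ℕ) :
    ∑ n ∈ Finset.range (N + 1), c n * (u n - u (n + 1)) =
      c 0 * u 0 - c N * u (N + 1) + ∑ n ∈ Finset.range N, (c (n + 1) - c n) * u (n + 1) := by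
  induction N with
  | zero => simp; ring
  | succ N ih => rw [Finset.sum_range_succ, ih, Finset.sum_range_succ _ N]; ring

theorem two_mul_le_sin_pi_mul {x θ : ℝ} (hθ : 0 ≤ θ) (h1 : θ ≤ x) (h2 : x ≤ 1 - θ) :
    2 * θ ≤ sin (π * x) := by
  have hπ := pi_pos
  rcases le_total x (1 / 2) with h | h
  · have := mul_le_sin (x := π * x) (mul_nonneg hπ.le (by linarith)) (by nlinarith)
    calc 2 * θ ≤ 2 * x := by linarith
      _ = 2 / π * (π * x) := by field_simp
      _ ≤ _ := this
  · have := mul_le_sin (x := π * (1 - x)) (mul_nonneg hπ.le (by linarith)) (by nlinarith)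
    rw [show π * (1 - x) = π - π * x by ring, sin_pi_sub] at this
    calc 2 * θ ≤ 2 * (1 - x) := by linarith
      _ = 2 / π * (π - π * x) := by field_simp
      _ ≤ _ := this

theorem norm_sum_addChar_le_of_sub_mem_zero {a : ℕ → ℝ} {N : ℕ} {θ : ℝ} (hθ : 0 < θ)
    (hlo : ∀ n < N, θ ≤ a (n + 1) - a n) (hhi : ∀ n < N, a (n + 1) - a n ≤ 1 - θ)
    (hmono : ∀ n, n + 1 < N → a (n + 1) - a n ≤ a (n + 2) - a (n + 1)) :
    ‖∑ n ∈ Finset.range N, addChar (a n)‖ ≤ 1 / θ := by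
  obtain _ | N := N
  · simp; positivity
  set s : ℕ → ℝ := fun n => sin (π * (a (n + 1) - a n)) with hs
  set t : ℕ → ℝ := fun n => cos (π * (a (n + 1) - a n)) / s n with ht
  set c : ℕ → ℂ := fun n => (1 + t n * Complex.I) / 2 with hc
  have hspos : ∀ n < N + 1, 2 * θ ≤ s n := fun n hn =>
    two_mul_le_sin_pi_mul hθ.le (hlo n hn) (hhi n hn)
  have htabs : ∀ n < N + 1, |t n| ≤ 1 / (2 * θ) := by
    intro n hn
    have h1 := hspos n hn
    rw [ht, abs_div, abs_of_pos (by linarith : 0 < s n)]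
    exact div_le_div₀ zero_le_one (abs_cos_le_one _) (by positivity) h1
  have hcnorm : ∀ n < N + 1, ‖c n‖ ≤ 1 / (4 * θ) := by
    intro n hn
    have h1 := hspos n hn
    have hpos : 0 < s n := by linarith
    have h2 : ‖(1 + t n * Complex.I : ℂ)‖ = 1 / s n := by
      have : (1 + t n * Complex.I : ℂ) = ((1 : ℝ) : ℂ) + t n * Complex.I := by simp
      rw [this, Complex.norm_add_mul_I]
      rw [sqrt_eq_iff_mul_self_eq (by positivity) (by positivity)]
      simp only [ht]
      field_simp
      nlinarith [sin_sq_add_cos_sq (π * (a (n + 1) - a n))]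
    rw [hc]
    simp only [norm_div, h2]
    rw [show ‖(2 : ℂ)‖ = 2 by simp, div_div]
    exact one_div_le_one_div_of_le (by positivity) (by linarith)
  have hterm : ∀ n < N + 1, addChar (a n) = c n * (addChar (a n) - addChar (a (n + 1))) := by
    intro n hn
    have hpos : 0 < s n := by linarith [hspos n hn]
    have h1 : addChar (a (n + 1)) = addChar (a n) * addChar (a (n + 1) - a n) := by
      rw [← addChar_add]; congr 1; ring
    rw [h1, addChar_eq (a (n + 1) - a n),
      show 2 * π * (a (n + 1) - a n) = 2 * (π * (a (n + 1) - a n)) by ring, cos_two_mul, sin_two_mul]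
    have h2 : c n * (1 - (((2 * cos (π * (a (n + 1) - a n)) ^ 2 - 1 : ℝ) : ℂ) +
        ((2 * sin (π * (a (n + 1) - a n)) * cos (π * (a (n + 1) - a n)) : ℝ) : ℂ) * Complex.I)) = 1 := by
      have hcc : (cos (π * (a (n + 1) - a n)) : ℝ) = t n * s n := by
        rw [ht]; field_simp
      have hcs := sin_sq_add_cos_sq (π * (a (n + 1) - a n))
      change (1 + t n * Complex.I) / 2 * (1 - (((2 * cos (π * (a (n + 1) - a n)) ^ 2 - 1 : ℝ) : ℂ) +
        ((2 * s n * cos (π * (a (n + 1) - a n)) : ℝ) : ℂ) * Complex.I)) = 1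
      change s n ^ 2 + _ = 1 at hcs
      rw [hcc] at hcs ⊢
      have hcs' : ((s n : ℂ)) ^ 2 * (1 + t n ^ 2) = 1 := by
        exact_mod_cast (by linarith : s n ^ 2 * (1 + t n ^ 2) = 1)
      push_cast
      linear_combination (-(t n * Complex.I)) * hcs' - (t n ^ 2 * s n ^ 2) * Complex.I_sq
    linear_combination (-addChar (a n)) * h2
  have htdiff : ∀ n < N, 0 ≤ t n - t (n + 1) := by
    intro n hn
    have p1 : 0 < s n := by linarith [hspos n (by omega)]
    have p2 : 0 < s (n + 1) := by linarith [hspos (n + 1) (by omega)]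
    have h3 : t n - t (n + 1) =
        sin (π * (a (n + 2) - a (n + 1)) - π * (a (n + 1) - a n)) / (s n * s (n + 1)) := by
      rw [sin_sub]
      simp only [ht]
      change _ = (s (n + 1) * _ - _ * s n) / _
      field_simp
    rw [h3]
    have l1 := hlo n (by omega)
    have l2 := hhi n (by omega)
    have l3 := hlo (n + 1) (by omega)
    have l4 := hhi (n + 1) (by omega)
    have l5 := hmono n (by omega)
    have hπ := pi_pos
    simp only [add_assoc, Nat.reduceAdd] at l3 l4
    refine div_nonneg (sin_nonneg_of_nonneg_of_le_pi ?_ ?_) (by positivity)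
    · nlinarith
    · nlinarith
  have hcdiff : ∀ n < N, ‖(c (n + 1) - c n) * addChar (a (n + 1))‖ = (t n - t (n + 1)) / 2 := by
    intro n hn
    rw [norm_mul, norm_addChar, mul_one]
    have : c (n + 1) - c n = ((-(t n - t (n + 1)) / 2 : ℝ) : ℂ) * Complex.I := by
      simp only [hc]; push_cast; ring
    rw [this, norm_mul, Complex.norm_I, mul_one, Complex.norm_real, norm_eq_abs, neg_div, abs_neg,
      abs_of_nonneg (by linarith [htdiff n hn])]
  rw [Finset.sum_congr rfl fun n hn => hterm n (Finset.mem_range.1 hn),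
    sum_range_mul_sub_succ c (fun n => addChar (a n))]
  have h4 : ‖∑ n ∈ Finset.range N, (c (n + 1) - c n) * addChar (a (n + 1))‖ ≤ 1 / (2 * θ) := by
    refine (norm_sum_le _ _).trans ?_
    rw [Finset.sum_congr rfl fun n hn => hcdiff n (Finset.mem_range.1 hn), ← Finset.sum_div,
      Finset.sum_range_sub']
    have := abs_le.1 (htabs 0 (by omega))
    have := abs_le.1 (htabs N (by omega))
    linarith
  have h5 := hcnorm 0 (by omega)
  have h6 := hcnorm N (by omega)
  refine (norm_add_le _ _).trans ?_
  refine (add_le_add (norm_sub_le _ _) h4).trans ?_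
  rw [norm_mul, norm_mul, norm_addChar, norm_addChar, mul_one, mul_one]
  have : 1 / θ = 1 / (4 * θ) + 1 / (4 * θ) + 1 / (2 * θ) := by field_simp; norm_num
  linarith

/-- The Kusmin–Landau inequality for a sequence with monotone differences. -/
theorem norm_sum_addChar_le_of_sub_mem {a : ℕ → ℝ} {p q : ℕ} {j : ℤ} {θ : ℝ} (hθ : 0 < θ)
    (hlo : ∀ n, p ≤ n → n < q → j + θ ≤ a (n + 1) - a n)
    (hhi : ∀ n, p ≤ n → n < q → a (n + 1) - a n ≤ j + 1 - θ)
    (hmono : ∀ n, p ≤ n → n + 1 < q → a (n + 1) - a n ≤ a (n + 2) - a (n + 1)) :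
    ‖∑ n ∈ Finset.Ico p q, addChar (a n)‖ ≤ 1 / θ := by
  rw [Finset.sum_Ico_eq_sum_range]
  have h1 : ∀ n, addChar (a (p + n)) = addChar (a (p + n) - j * n) := by
    intro n
    have : a (p + n) = (a (p + n) - j * n) + ((j * n : ℤ) : ℝ) := by push_cast; ring
    conv_lhs => rw [this, addChar_add, addChar_int, mul_one]
  simp_rw [h1]
  refine norm_sum_addChar_le_of_sub_mem_zero (a := fun n => a (p + n) - j * n) hθ ?_ ?_ ?_
  · intro n hn
    have := hlo (p + n) (by omega) (by omega)
    push_cast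
    rw [← add_assoc]
    linarith
  · intro n hn
    have := hhi (p + n) (by omega) (by omega)
    push_cast
    rw [← add_assoc]
    linarith
  · intro n hn
    have := hmono (p + n) (by omega) (by omega)
    push_cast
    rw [← add_assoc, ← add_assoc]
    linarith

theorem Finset.exists_eq_Ico_of_ordConnected {S : Finset ℕ} (h : (S : Set ℕ).OrdConnected) :
    ∃ p q, S = Finset.Ico p q := by
  rcases S.eq_empty_or_nonempty with rfl | hne
  · exact ⟨0, 0, by simp⟩
  · refine ⟨S.min' hne, S.max' hne + 1, ?_⟩
    ext n
    simp only [Finset.mem_Ico, Nat.lt_succ_iff]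
    refine ⟨fun hn => ⟨S.min'_le n hn, S.le_max' n hn⟩, fun hn => ?_⟩
    exact_mod_cast h.out (S.min'_mem hne) (S.max'_mem hne) hn

theorem exists_filter_range_eq_Ico {g : ℕ → ℝ} {L : ℕ}
    (hg : ∀ m n, m ≤ n → n < L → g m ≤ g n) {I : Set ℝ} (hI : I.OrdConnected)
    [DecidablePred fun n => g n ∈ I] :
    ∃ p q, (Finset.range L).filter (fun n => g n ∈ I) = Finset.Ico p q := by
  refine Finset.exists_eq_Ico_of_ordConnected ⟨fun x hx y hy z hz => ?_⟩
  simp only [Finset.coe_filter, Finset.mem_range, Set.mem_ofPred_eq] at hx hy ⊢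
  have hz2 : z < L := hz.2.trans_lt hy.1
  exact ⟨hz2, hI.out hx.2 hy.2 ⟨hg _ _ hz.1 hz2, hg _ _ hz.2 hy.1⟩⟩

theorem add_mul_le_of_forall_add_le {g : ℕ → ℝ} {L : ℕ} {lam : ℝ}
    (hg : ∀ n, n + 1 < L → g n + lam ≤ g (n + 1)) (m k : ℕ) (h : m + k < L) :
    g m + k * lam ≤ g (m + k) := by
  induction k with
  | zero => simp
  | succ k ih =>
    have := hg (m + k) (by omega)
    have := ih (by omega)
    push_cast
    rw [← add_assoc]
    linarith

theorem card_filter_Icc_le {g : ℕ → ℝ} {L : ℕ} {lam : ℝ} (hlam : 0 < lam)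
    (hg : ∀ n, n + 1 < L → g n + lam ≤ g (n + 1)) {lo w : ℝ} (hw : 0 ≤ w) (S : Finset ℕ)
    (hS : ∀ n ∈ S, n < L ∧ lo ≤ g n ∧ g n ≤ lo + w) : (S.card : ℝ) ≤ w / lam + 1 := by
  rcases S.eq_empty_or_nonempty with rfl | hne
  · simp; positivity
  · have h1 := hS _ (S.min'_mem hne)
    have h2 := hS _ (S.max'_mem hne)
    have h3 : S.min' hne ≤ S.max' hne := S.min'_le _ (S.max'_mem hne)
    obtain ⟨k, hk⟩ := Nat.exists_eq_add_of_le h3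
    have h4 := add_mul_le_of_forall_add_le hg (S.min' hne) k (by omega)
    rw [← hk] at h4
    have h5 : (k : ℝ) ≤ w / lam := by
      rw [le_div_iff₀ hlam]
      linarith
    have h6 : S ⊆ Finset.Icc (S.min' hne) (S.max' hne) := fun n hn =>
      Finset.mem_Icc.2 ⟨S.min'_le n hn, S.le_max' n hn⟩
    have h7 := Finset.card_le_card h6
    rw [Nat.card_Icc] at h7
    have h8 : (S.card : ℝ) ≤ (k + 1 : ℕ) := by exact_mod_cast (by omega)
    push_cast at h8
    linarith

theorem norm_sum_addChar_le_card (a : ℕ → ℝ) (S : Finset ℕ) :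
    ‖∑ n ∈ S, addChar (a n)‖ ≤ S.card :=
  (norm_sum_le _ _).trans (by simp [norm_addChar])

theorem norm_sum_addChar_filter_floor_le {a : ℕ → ℝ} {L : ℕ} {lam : ℝ} (hlam : 0 < lam)
    (hlam' : lam ≤ 1 / 4)
    (hg : ∀ n, n + 1 < L → (a (n + 1) - a n) + lam ≤ a (n + 1 + 1) - a (n + 1)) (j : ℤ) :
    ‖∑ n ∈ (Finset.range L).filter (fun n => ⌊a (n + 1) - a n⌋ = j), addChar (a n)‖ ≤
      4 / √lam := by
  set g : ℕ → ℝ := fun n => a (n + 1) - a n with hgdef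
  set θ := √lam with hθ
  have hθ0 : 0 < θ := sqrt_pos.2 hlam
  have hθ2 : θ ^ 2 = lam := sq_sqrt hlam.le
  have hθ1 : θ ≤ 1 / 2 := by nlinarith
  have hmono : ∀ m n, m ≤ n → n < L → g m ≤ g n := by
    intro m n hmn hn
    obtain ⟨k, rfl⟩ := Nat.exists_eq_add_of_le hmn
    have := add_mul_le_of_forall_add_le (g := g) hg m k hn
    have : 0 ≤ k * lam := by positivity
    linarith
  set F := (Finset.range L).filter (fun n => ⌊g n⌋ = j) with hF
  have hFm : ∀ n ∈ F, n < L ∧ (j : ℝ) ≤ g n ∧ g n < j + 1 := by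
    intro n hn
    rw [hF, Finset.mem_filter, Finset.mem_range, Int.floor_eq_iff] at hn
    exact hn
  classical
  have hsplit : ∑ n ∈ F, addChar (a n) =
      ∑ n ∈ F.filter (fun n => g n < j + θ), addChar (a n) +
      (∑ n ∈ (F.filter (fun n => ¬ g n < j + θ)).filter (fun n => g n ≤ j + 1 - θ), addChar (a n) +
      ∑ n ∈ (F.filter (fun n => ¬ g n < j + θ)).filter (fun n => ¬ g n ≤ j + 1 - θ),
        addChar (a n)) := by
    rw [Finset.sum_filter_add_sum_filter_not, Finset.sum_filter_add_sum_filter_not]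
  rw [hsplit]
  have b1 : ‖∑ n ∈ F.filter (fun n => g n < j + θ), addChar (a n)‖ ≤ θ / lam + 1 := by
    refine (norm_sum_addChar_le_card _ _).trans
      (card_filter_Icc_le hlam hg (lo := j) hθ0.le _ fun n hn => ?_)
    rw [Finset.mem_filter] at hn
    exact ⟨(hFm n hn.1).1, (hFm n hn.1).2.1, hn.2.le⟩
  have b3 : ‖∑ n ∈ (F.filter (fun n => ¬ g n < j + θ)).filter (fun n => ¬ g n ≤ j + 1 - θ),
      addChar (a n)‖ ≤ θ / lam + 1 := by
    refine (norm_sum_addChar_le_card _ _).trans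
      (card_filter_Icc_le hlam hg (lo := j + 1 - θ) hθ0.le _ fun n hn => ?_)
    rw [Finset.mem_filter, Finset.mem_filter, not_le] at hn
    exact ⟨(hFm n hn.1.1).1, hn.2.le, by linarith [(hFm n hn.1.1).2.2]⟩
  have b2 : ‖∑ n ∈ (F.filter (fun n => ¬ g n < j + θ)).filter (fun n => g n ≤ j + 1 - θ),
      addChar (a n)‖ ≤ 1 / θ := by
    have heq : (F.filter (fun n => ¬ g n < j + θ)).filter (fun n => g n ≤ j + 1 - θ) =
        (Finset.range L).filter (fun n => g n ∈ Set.Icc (j + θ) (j + 1 - θ)) := by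
      ext n
      simp only [hF, Finset.mem_filter, Set.mem_Icc, not_lt, Int.floor_eq_iff]
      constructor
      · rintro ⟨⟨h1, h2⟩, h3⟩
        exact ⟨h1.1, h2, h3⟩
      · rintro ⟨h1, h2, h3⟩
        exact ⟨⟨⟨h1, by linarith, by linarith⟩, h2⟩, h3⟩
    obtain ⟨p, q, hpq⟩ := exists_filter_range_eq_Ico hmono
      (I := Set.Icc (j + θ) (j + 1 - θ)) Set.ordConnected_Icc
    rw [heq, hpq]
    have hm : ∀ n, p ≤ n → n < q → n < L ∧ g n ∈ Set.Icc (j + θ) (j + 1 - θ) := by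
      intro n h1 h2
      have : n ∈ Finset.Ico p q := Finset.mem_Ico.2 ⟨h1, h2⟩
      rw [← hpq, Finset.mem_filter, Finset.mem_range] at this
      exact this
    refine norm_sum_addChar_le_of_sub_mem hθ0 (fun n h1 h2 => (hm n h1 h2).2.1)
      (fun n h1 h2 => (hm n h1 h2).2.2) (fun n h1 h2 => ?_)
    exact hmono n (n + 1) (by omega) (hm (n + 1) (by omega) h2).1
  have e1 : θ / lam = 1 / θ := by rw [← hθ2]; field_simp
  have e2 : 1 ≤ 1 / θ * (1 / 2) := by rw [div_mul_div_comm, le_div_iff₀ (by positivity)]; linarith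
  refine (norm_add_le _ _).trans ((add_le_add b1 ((norm_add_le _ _).trans (add_le_add b2 b3))).trans ?_)
  rw [e1, show 4 / θ = 4 * (1 / θ) by ring]
  linarith

/-- The second derivative test of van der Corput, for sequences. -/
theorem norm_sum_addChar_le_of_fwdDiff_two {C : ℝ} (hC : 1 ≤ C) {a : ℕ → ℝ} {L : ℕ} {lam : ℝ}
    (hlam : 0 < lam)
    (ha : ∀ n < L, lam ≤ (fwdDiff 1)^[2] a n ∧ (fwdDiff 1)^[2] a n ≤ C * lam) :
    ‖∑ n ∈ Finset.range L, addChar (a n)‖ ≤ 8 * C * (L * √lam + 1 / √lam) := by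
  have hs : 0 < √lam := sqrt_pos.2 hlam
  have hs2 : √lam ^ 2 = lam := sq_sqrt hlam.le
  rcases le_or_gt lam (1 / 4) with h4 | h4
  swap
  · refine (norm_sum_addChar_le_card _ _).trans ?_
    rw [Finset.card_range]
    have : 1 / 2 ≤ √lam := by
      rw [le_sqrt (by norm_num) hlam.le]
      linarith
    have h1 : (L : ℝ) ≤ 2 * (L * √lam) := by nlinarith [(Nat.cast_nonneg L : (0 : ℝ) ≤ L)]
    have h2 : 0 ≤ L * √lam := by positivity
    have h3 : 0 < 1 / √lam := by positivity
    nlinarith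
  have hd : ∀ n, (fwdDiff 1)^[2] a n = (a (n + 1 + 1) - a (n + 1)) - (a (n + 1) - a n) := by
    intro n; simp [fwdDiff]
  have hg : ∀ n, n + 1 < L → (a (n + 1) - a n) + lam ≤ a (n + 1 + 1) - a (n + 1) := by
    intro n hn
    have := (ha n (by omega)).1
    rw [hd] at this
    linarith
  obtain rfl | hL := Nat.eq_zero_or_pos L
  · simp; positivity
  have hup : ∀ n < L, a (n + 1) - a n ≤ (a 1 - a 0) + n * (C * lam) := by
    intro n
    induction n with
    | zero => simp
    | succ n ih =>
      intro hn
      have := (ha n (by omega)).2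
      rw [hd] at this
      have := ih (by omega)
      push_cast
      linarith
  have hlow : ∀ n < L, a 1 - a 0 ≤ a (n + 1) - a n := by
    intro n hn
    have := add_mul_le_of_forall_add_le (g := fun n => a (n + 1) - a n) hg 0 n (by omega)
    simp only [zero_add] at this
    have : 0 ≤ n * lam := by positivity
    linarith
  set J := Finset.Icc ⌊a 1 - a 0⌋ ⌊(a 1 - a 0) + L * (C * lam)⌋ with hJ
  have hmap : ∀ n ∈ Finset.range L, ⌊a (n + 1) - a n⌋ ∈ J := by
    intro n hn
    rw [Finset.mem_range] at hn
    rw [hJ, Finset.mem_Icc]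
    refine ⟨Int.floor_le_floor (hlow n hn), Int.floor_le_floor ((hup n hn).trans ?_)⟩
    have : (n : ℝ) ≤ L := by exact_mod_cast hn.le
    gcongr
  rw [← Finset.sum_fiberwise_of_maps_to hmap]
  refine (norm_sum_le _ _).trans ((Finset.sum_le_sum fun j _ =>
    norm_sum_addChar_filter_floor_le hlam h4 hg j).trans ?_)
  rw [Finset.sum_const, nsmul_eq_mul]
  have hcard : (J.card : ℝ) ≤ L * (C * lam) + 2 := by
    rw [hJ, Int.card_Icc]
    have h0 : ⌊a 1 - a 0⌋ ≤ ⌊(a 1 - a 0) + L * (C * lam)⌋ := by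
      apply Int.floor_le_floor
      have : 0 ≤ L * (C * lam) := by positivity
      linarith
    have h1 : ((⌊(a 1 - a 0) + L * (C * lam)⌋ + 1 - ⌊a 1 - a 0⌋).toNat : ℝ) =
        (⌊(a 1 - a 0) + L * (C * lam)⌋ : ℝ) + 1 - ⌊a 1 - a 0⌋ := by
      have : ((⌊(a 1 - a 0) + L * (C * lam)⌋ + 1 - ⌊a 1 - a 0⌋).toNat : ℤ) =
        ⌊(a 1 - a 0) + L * (C * lam)⌋ + 1 - ⌊a 1 - a 0⌋ := Int.toNat_of_nonneg (by omega)
      exact_mod_cast this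
    rw [h1]
    have := Int.floor_le ((a 1 - a 0) + L * (C * lam))
    have := Int.lt_floor_add_one (a 1 - a 0)
    linarith
  calc (J.card : ℝ) * (4 / √lam) ≤ (L * (C * lam) + 2) * (4 / √lam) := by gcongr
    _ = 4 * C * L * √lam + 8 * (1 / √lam) := by
      nth_rewrite 1 [← hs2]
      field_simp
      ring
    _ ≤ 8 * C * (L * √lam + 1 / √lam) := by
      have h2 : 0 ≤ C * (L * √lam) := by positivity
      have h3 : 0 < 1 / √lam := by positivity
      nlinarith

theorem sum_range_if_sub_eq (u : ℕ → ℂ) {L H h : ℕ} (hH : h ≤ H) :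
    ∑ m ∈ Finset.range (L + H), (if h ≤ m ∧ m < L + h then u (m - h) else 0) =
      ∑ n ∈ Finset.range L, u n := by
  rw [← Finset.sum_filter]
  have : (Finset.range (L + H)).filter (fun m => h ≤ m ∧ m < L + h) = Finset.Ico h (L + h) := by
    ext m; simp only [Finset.mem_filter, Finset.mem_range, Finset.mem_Ico]; omega
  rw [this, Finset.sum_Ico_eq_sum_range]
  simp

theorem norm_sum_range_if_mul_conj (u : ℕ → ℂ) {L H h d : ℕ} (hH : h + d ≤ H) :
    ‖∑ m ∈ Finset.range (L + H), (if h ≤ m ∧ m < L + h then u (m - h) else 0) *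
      (starRingEnd ℂ) (if h + d ≤ m ∧ m < L + (h + d) then u (m - (h + d)) else 0)‖ =
      ‖∑ n ∈ Finset.range (L - d), u (n + d) * (starRingEnd ℂ) (u n)‖ := by
  have h1 : ∀ m, (if h ≤ m ∧ m < L + h then u (m - h) else 0) *
      (starRingEnd ℂ) (if h + d ≤ m ∧ m < L + (h + d) then u (m - (h + d)) else 0) =
      if h + d ≤ m ∧ m < L + h then u (m - h) * (starRingEnd ℂ) (u (m - (h + d))) else 0 := by
    intro m
    split_ifs <;> first | omega | simp
  simp_rw [h1]
  rw [← Finset.sum_filter]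
  have : (Finset.range (L + H)).filter (fun m => h + d ≤ m ∧ m < L + h) =
      Finset.Ico (h + d) (L + h) := by
    ext m; simp only [Finset.mem_filter, Finset.mem_range, Finset.mem_Ico]; omega
  rw [this, Finset.sum_Ico_eq_sum_range]
  congr 1
  refine Finset.sum_congr (by congr 1; omega) fun n _ => ?_
  rw [show h + d + n - h = n + d by omega, show h + d + n - (h + d) = n by omega]

theorem sum_range_dist_le {c : ℕ → ℝ} (hc : ∀ d, 0 ≤ c d) {H h : ℕ} (hh : h < H) :
    ∑ k ∈ Finset.range H, c ((h - k) + (k - h)) ≤ 2 * ∑ d ∈ Finset.range H, c d := by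
  rw [← Finset.sum_filter_add_sum_filter_not (Finset.range H) (fun k => k ≤ h), two_mul]
  refine add_le_add ?_ ?_
  · rw [← Finset.sum_image (f := c) (g := fun k => (h - k) + (k - h))]
    · refine Finset.sum_le_sum_of_subset_of_nonneg (fun d hd => ?_) fun _ _ _ => hc _
      simp only [Finset.mem_image, Finset.mem_filter, Finset.mem_range] at hd ⊢
      omega
    · intro x hx y hy hxy
      simp only [Finset.coe_filter, Finset.mem_range, Set.mem_ofPred_eq] at hx hy hxy
      omega
  · rw [← Finset.sum_image (f := c) (g := fun k => (h - k) + (k - h))]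
    · refine Finset.sum_le_sum_of_subset_of_nonneg (fun d hd => ?_) fun _ _ _ => hc _
      simp only [Finset.mem_image, Finset.mem_filter, Finset.mem_range] at hd ⊢
      omega
    · intro x hx y hy hxy
      simp only [Finset.coe_filter, Finset.mem_range, Set.mem_ofPred_eq] at hx hy hxy
      omega

/-- The Weyl–van der Corput inequality. -/
theorem sq_norm_sum_le_weyl (u : ℕ → ℂ) (L H : ℕ) :
    (H : ℝ) * ‖∑ n ∈ Finset.range L, u n‖ ^ 2 ≤
      2 * (L + H) * ∑ d ∈ Finset.range H,
        ‖∑ n ∈ Finset.range (L - d), u (n + d) * (starRingEnd ℂ) (u n)‖ := by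
  set c : ℕ → ℝ := fun d => ‖∑ n ∈ Finset.range (L - d), u (n + d) * (starRingEnd ℂ) (u n)‖ with hc
  set w : ℕ → ℕ → ℂ := fun m h => if h ≤ m ∧ m < L + h then u (m - h) else 0 with hw
  have h1 : (H : ℂ) * ∑ n ∈ Finset.range L, u n =
      ∑ m ∈ Finset.range (L + H), ∑ h ∈ Finset.range H, w m h := by
    rw [Finset.sum_comm, Finset.sum_congr rfl fun h hh =>
      sum_range_if_sub_eq u (L := L) (Finset.mem_range.1 hh).le]
    simp
  have h2 : ∀ h < H, ∀ k < H,
      ‖∑ m ∈ Finset.range (L + H), w m h * (starRingEnd ℂ) (w m k)‖ = c ((h - k) + (k - h)) := by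
    intro h hh k hk
    rcases le_total h k with hle | hle
    · obtain ⟨d, rfl⟩ := Nat.exists_eq_add_of_le hle
      rw [show h - (h + d) + (h + d - h) = d by omega]
      exact norm_sum_range_if_mul_conj u hk.le
    · obtain ⟨d, rfl⟩ := Nat.exists_eq_add_of_le hle
      rw [show k + d - k + (k - (k + d)) = d by omega]
      have : ∑ m ∈ Finset.range (L + H), w m (k + d) * (starRingEnd ℂ) (w m k) =
          (starRingEnd ℂ) (∑ m ∈ Finset.range (L + H), w m k * (starRingEnd ℂ) (w m (k + d))) := by
        simp only [map_sum, map_mul, Complex.conj_conj]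
        exact Finset.sum_congr rfl fun _ _ => mul_comm _ _
      rw [this, RCLike.norm_conj]
      exact norm_sum_range_if_mul_conj u hh.le
  have h3 : ∑ m ∈ Finset.range (L + H), ‖∑ h ∈ Finset.range H, w m h‖ ^ 2 ≤
      H * (2 * ∑ d ∈ Finset.range H, c d) := by
    have e1 : ((∑ m ∈ Finset.range (L + H), ‖∑ h ∈ Finset.range H, w m h‖ ^ 2 : ℝ) : ℂ) =
        ∑ h ∈ Finset.range H, ∑ k ∈ Finset.range H,
          ∑ m ∈ Finset.range (L + H), w m h * (starRingEnd ℂ) (w m k) := by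
      push_cast
      simp_rw [← Complex.mul_conj', map_sum, Finset.sum_mul_sum]
      rw [Finset.sum_comm]
      exact Finset.sum_congr rfl fun _ _ => Finset.sum_comm
    have e2 : ∑ m ∈ Finset.range (L + H), ‖∑ h ∈ Finset.range H, w m h‖ ^ 2 =
        ‖((∑ m ∈ Finset.range (L + H), ‖∑ h ∈ Finset.range H, w m h‖ ^ 2 : ℝ) : ℂ)‖ := by
      rw [Complex.norm_real, norm_of_nonneg (by positivity)]
    rw [e2, e1]
    refine (norm_sum_le _ _).trans ?_
    have : ∀ h ∈ Finset.range H, ‖∑ k ∈ Finset.range H,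
        ∑ m ∈ Finset.range (L + H), w m h * (starRingEnd ℂ) (w m k)‖ ≤
        2 * ∑ d ∈ Finset.range H, c d := by
      intro h hh
      refine (norm_sum_le _ _).trans ?_
      rw [Finset.sum_congr rfl fun k hk => h2 h (Finset.mem_range.1 hh) k (Finset.mem_range.1 hk)]
      exact sum_range_dist_le (fun d => by simp only [hc]; positivity) (Finset.mem_range.1 hh)
    refine (Finset.sum_le_sum this).trans ?_
    simp
  have h4 : ((H : ℝ) * ‖∑ n ∈ Finset.range L, u n‖) ^ 2 ≤
      (L + H) * (H * (2 * ∑ d ∈ Finset.range H, c d)) := by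
    have : (H : ℝ) * ‖∑ n ∈ Finset.range L, u n‖ =
        ‖∑ m ∈ Finset.range (L + H), ∑ h ∈ Finset.range H, w m h‖ := by
      rw [← h1, norm_mul, Complex.norm_natCast]
    rw [this]
    calc _ ≤ (∑ m ∈ Finset.range (L + H), ‖∑ h ∈ Finset.range H, w m h‖) ^ 2 := by
          gcongr; exact norm_sum_le _ _
      _ ≤ (L + H) * ∑ m ∈ Finset.range (L + H), ‖∑ h ∈ Finset.range H, w m h‖ ^ 2 := by
          simpa using sq_sum_le_card_mul_sum_sq (s := Finset.range (L + H))
            (f := fun m => ‖∑ h ∈ Finset.range H, w m h‖)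
      _ ≤ _ := by gcongr
  rcases Nat.eq_zero_or_pos H with rfl | hH
  · simp
  · have hH' : (0 : ℝ) < H := by exact_mod_cast hH
    refine le_of_mul_le_mul_left ?_ hH'
    calc _ = ((H : ℝ) * ‖∑ n ∈ Finset.range L, u n‖) ^ 2 := by ring
      _ ≤ _ := h4
      _ = _ := by ring

theorem fwdDiff_iter_shift_sub (a : ℕ → ℝ) (m d n : ℕ) :
    (fwdDiff 1)^[m] (fun n => a (n + d) - a n) n =
      ∑ j ∈ Finset.range d, (fwdDiff 1)^[m + 1] a (n + j) := by
  have h1 : ∀ m n, (fwdDiff 1)^[m] (fun n => a (n + d) - a n) n =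
      (fwdDiff 1)^[m] a (n + d) - (fwdDiff 1)^[m] a n := by
    intro m
    induction m with
    | zero => simp
    | succ m ih =>
      intro n
      simp only [Function.iterate_succ_apply', fwdDiff, ih]
      rw [show n + 1 + d = n + d + 1 by ring]
      ring
  have h2 : ∀ x, (fwdDiff 1)^[m + 1] a x = (fwdDiff 1)^[m] a (x + 1) - (fwdDiff 1)^[m] a x := by
    intro x
    rw [Function.iterate_succ_apply']
    rfl
  rw [h1]
  simp_rw [h2]
  exact (Finset.sum_range_sub (fun j => (fwdDiff 1)^[m] a (n + j)) d).symm

theorem sum_range_one_div_sqrt_le (h : ℕ) :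
    ∑ d ∈ Finset.range (h + 1), 1 / √(d : ℝ) ≤ 2 * √(h : ℝ) := by
  induction h with
  | zero => simp
  | succ h ih =>
    rw [Finset.sum_range_succ]
    have h1 : 0 < √((h + 1 : ℕ) : ℝ) := sqrt_pos.2 (by positivity)
    have h2 : √((h + 1 : ℕ) : ℝ) ^ 2 = h + 1 := by rw [sq_sqrt (by positivity)]; push_cast; rfl
    have h3 : √(h : ℝ) ^ 2 = h := sq_sqrt (by positivity)
    have h4 : 1 / √((h + 1 : ℕ) : ℝ) ≤ 2 * (√((h + 1 : ℕ) : ℝ) - √(h : ℝ)) := by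
      rw [div_le_iff₀ h1]
      nlinarith [sq_nonneg (√((h + 1 : ℕ) : ℝ) - √(h : ℝ))]
    linarith

theorem pow_div_le_sum_pow_div {f : ℕ → ℝ} {h Q : ℕ} (hf : ∀ d, 0 ≤ f d) (hh : 0 < h)
    (hQ : 0 < Q) :
    ((∑ d ∈ Finset.range h, f d) / h) ^ Q ≤ (∑ d ∈ Finset.range h, f d ^ Q) / h := by
  obtain ⟨n, rfl⟩ := Nat.exists_eq_succ_of_ne_zero hQ.ne'
  have := pow_sum_div_card_le_sum_pow (s := Finset.range h) (f := f) (fun i _ => hf i) n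
  rw [Finset.card_range] at this
  have hh' : (0 : ℝ) < h := by exact_mod_cast hh
  calc _ = ((∑ d ∈ Finset.range h, f d) ^ (n + 1) / h ^ n) / h := by
        rw [Nat.succ_eq_add_one, div_pow, pow_succ (h : ℝ) n, div_div]
    _ ≤ _ := by gcongr

theorem pow_le_of_le_four_mul_add {X u Y R B E S T : ℝ} {Q : ℕ} (hQ : 0 < Q) (hu : 0 ≤ u)
    (hY : 0 ≤ Y) (hR : 0 ≤ R) (hE : 0 ≤ E) (hS : 0 ≤ S) (hT : 0 ≤ T) (hB : 0 ≤ B) (hX : 0 ≤ X)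
    (h1 : X ≤ 4 * (u + Y)) (h2 : u ≤ 2 * R) (h3 : Y ^ Q ≤ B * (E + S + 4 * T)) :
    X ^ Q ≤ 8 ^ Q * (2 ^ Q + 4 * B) * (E + R ^ Q + S + T) := by
  have hRQ : 0 ≤ R ^ Q := by positivity
  have hG : (0 : ℝ) ≤ 2 ^ Q := by positivity
  have h4 : u ^ Q + Y ^ Q ≤ (2 ^ Q + 4 * B) * (E + R ^ Q + S + T) := by
    have h5 : u ^ Q ≤ 2 ^ Q * R ^ Q := by
      rw [← mul_pow]
      exact pow_le_pow_left₀ hu h2 Q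
    generalize (2 : ℝ) ^ Q = G at *
    generalize R ^ Q = V at *
    nlinarith [mul_nonneg hG hE, mul_nonneg hG hS, mul_nonneg hG hT, mul_nonneg hB hE,
      mul_nonneg hB hRQ, mul_nonneg hB hS]
  have h6 : (u + Y) ^ Q ≤ 2 ^ Q * (u ^ Q + Y ^ Q) := by
    refine (add_pow_le hu hY Q).trans ?_
    have : (2 : ℝ) ^ (Q - 1) ≤ 2 ^ Q := pow_le_pow_right₀ (by norm_num) (by omega)
    exact mul_le_mul_of_nonneg_right this (by positivity)
  calc X ^ Q ≤ (4 * (u + Y)) ^ Q := pow_le_pow_left₀ hX h1 Q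
    _ = 4 ^ Q * (u + Y) ^ Q := by rw [mul_pow]
    _ ≤ 4 ^ Q * (2 ^ Q * ((2 ^ Q + 4 * B) * (E + R ^ Q + S + T))) := by
        refine mul_le_mul_of_nonneg_left (h6.trans ?_) (by positivity)
        exact mul_le_mul_of_nonneg_left h4 hG
    _ = _ := by
        rw [← mul_assoc, ← mul_pow, ← mul_assoc]
        norm_num

set_option maxHeartbeats 400000 in
/-- Repeated Weyl differencing followed by the second derivative test. -/
theorem exists_pow_norm_sum_addChar_le (q : ℕ) {C : ℝ} (hC : 1 ≤ C) :
    ∃ B : ℝ, 1 ≤ B ∧ ∀ (N L : ℕ) (lam : ℝ) (a : ℕ → ℝ) (H : ℕ → ℝ), 0 < N → L ≤ N → 0 < lam →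
      (∀ j < q, 1 ≤ H j ∧ H j ≤ N) →
      (∀ n < L, lam ≤ (fwdDiff 1)^[q + 2] a n ∧ (fwdDiff 1)^[q + 2] a n ≤ C * lam) →
      (‖∑ n ∈ Finset.range L, addChar (a n)‖ / N) ^ (2 ^ q) ≤
        B * (∑ j ∈ Finset.range q, (1 / H j) ^ (2 ^ (q - 1 - j)) +
          √(lam * ∏ j ∈ Finset.range q, H j) +
          1 / (N * √(lam * ∏ j ∈ Finset.range q, H j))) := by
  induction q with
  | zero =>
    refine ⟨8 * C, by linarith, fun N L lam a H hN hL hlam _ ha => ?_⟩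
    have hN' : (0 : ℝ) < N := by exact_mod_cast hN
    have hs : 0 < √lam := sqrt_pos.2 hlam
    have hL' : (L : ℝ) ≤ N := by exact_mod_cast hL
    simp only [pow_zero, pow_one, Finset.range_zero, Finset.sum_empty, Finset.prod_empty, mul_one,
      zero_add]
    rw [div_le_iff₀ hN']
    refine (norm_sum_addChar_le_of_fwdDiff_two hC hlam ha).trans ?_
    rw [mul_assoc]
    have : (√lam + 1 / (N * √lam)) * N = N * √lam + 1 / √lam := by field_simp
    rw [mul_assoc (8 * C), this, mul_assoc]
    gcongr
  | succ q ih =>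
    obtain ⟨B, hB, ih⟩ := ih
    obtain ⟨Q, hQ⟩ : ∃ Q, Q = 2 ^ q := ⟨_, rfl⟩
    rw [← hQ] at ih
    have hQpos : 0 < Q := by rw [hQ]; positivity
    refine ⟨8 ^ Q * (2 ^ Q + 4 * B), ?_, fun N L lam a H hN hL hlam hH ha => ?_⟩
    · have : (1 : ℝ) ≤ 8 ^ Q := one_le_pow₀ (by norm_num)
      have : (1 : ℝ) ≤ 2 ^ Q := one_le_pow₀ (by norm_num)
      nlinarith
    have hN' : (0 : ℝ) < N := by exact_mod_cast hN
    have hL' : (L : ℝ) ≤ N := by exact_mod_cast hL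
    obtain ⟨hH1, hHN⟩ := hH 0 (by omega)
    set h := ⌊H 0⌋₊ with hh
    have hh1 : 1 ≤ h := Nat.one_le_floor_iff _ |>.2 hH1
    have hh1' : (1 : ℝ) ≤ h := by exact_mod_cast hh1
    have hhle : (h : ℝ) ≤ H 0 := Nat.floor_le (by linarith)
    have hhge : H 0 ≤ 2 * h := by
      have := Nat.lt_floor_add_one (H 0)
      linarith
    set x : ℕ → ℝ := fun d =>
      ‖∑ n ∈ Finset.range (L - d), addChar (a (n + d) - a n)‖ / N with hx
    set X := ‖∑ n ∈ Finset.range L, addChar (a n)‖ / N with hX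
    have hX0 : 0 ≤ X := by positivity
    have hx0 : ∀ d, 0 ≤ x d := fun d => by simp only [hx]; positivity
    have hx1 : x 0 ≤ 1 := by
      simp only [hx]
      rw [div_le_one hN']
      refine (norm_sum_addChar_le_card (fun n => a (n + 0) - a n) _).trans ?_
      simpa using hL
    have hweyl : h * X ^ 2 ≤ 4 * ∑ d ∈ Finset.range h, x d := by
      have h1 := sq_norm_sum_le_weyl (fun n => addChar (a n)) L h
      have h2 : ∀ d n, addChar (a (n + d)) * (starRingEnd ℂ) (addChar (a n)) =
          addChar (a (n + d) - a n) := by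
        intro d n
        rw [conj_addChar, ← addChar_add, sub_eq_add_neg]
      simp only [h2] at h1
      have h3 : ∑ d ∈ Finset.range h, x d = (∑ d ∈ Finset.range h,
          ‖∑ n ∈ Finset.range (L - d), addChar (a (n + d) - a n)‖) / N := by
        simp only [hx, Finset.sum_div]
      rw [h3, hX, div_pow, ← mul_div_assoc, ← mul_div_assoc, div_le_div_iff₀ (by positivity) hN']
      have h4 : 0 ≤ ∑ d ∈ Finset.range h,
          ‖∑ n ∈ Finset.range (L - d), addChar (a (n + d) - a n)‖ := by positivity
      have h5 : (2 * (L + h) : ℝ) ≤ 4 * N := by linarith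
      calc _ ≤ (4 * N * ∑ d ∈ Finset.range h,
          ‖∑ n ∈ Finset.range (L - d), addChar (a (n + d) - a n)‖) * N := by
            exact mul_le_mul_of_nonneg_right
              (h1.trans (mul_le_mul_of_nonneg_right h5 h4)) hN'.le
        _ = _ := by ring
    set f : ℕ → ℝ := fun d => if d = 0 then 0 else x d with hf
    have hf0 : ∀ d, 0 ≤ f d := fun d => by
      simp only [hf]; split_ifs
      · exact le_rfl
      · exact hx0 d
    have hsumx : ∑ d ∈ Finset.range h, x d ≤ 1 + ∑ d ∈ Finset.range h, f d := by
      obtain ⟨k, hk⟩ := Nat.exists_eq_succ_of_ne_zero (by omega : h ≠ 0)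
      rw [hk, Finset.sum_range_succ', Finset.sum_range_succ']
      simp only [hf]
      simp
      linarith
    set P := lam * ∏ j ∈ Finset.range q, H (j + 1) with hP
    have hPpos : 0 < P := mul_pos hlam (Finset.prod_pos fun j hj => by
      have := (hH (j + 1) (by have := Finset.mem_range.1 hj; omega)).1
      linarith)
    have hPeq : lam * ∏ j ∈ Finset.range (q + 1), H j = H 0 * P := by
      rw [Finset.prod_range_succ', hP]; ring
    set E := ∑ j ∈ Finset.range q, (1 / H (j + 1)) ^ (2 ^ (q - 1 - j)) with hE
    have hE0 : 0 ≤ E := Finset.sum_nonneg fun j hj => by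
      have := (hH (j + 1) (by have := Finset.mem_range.1 hj; omega)).1
      positivity
    have hEeq : ∑ j ∈ Finset.range (q + 1), (1 / H j) ^ (2 ^ (q + 1 - 1 - j)) =
        E + (1 / H 0) ^ Q := by
      rw [Finset.sum_range_succ', hE]
      congr 1
      · refine Finset.sum_congr rfl fun j hj => ?_
        congr 2
        omega
      · rw [hQ]; simp
    have hfd : ∀ d ∈ Finset.range h, f d ^ Q ≤ B * (E + √(H 0 * P) + 1 / (N * √P) * (1 / √d)) := by
      intro d hd
      rw [Finset.mem_range] at hd
      rcases Nat.eq_zero_or_pos d with rfl | hdpos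
      · simp only [hf, if_true]
        rw [zero_pow hQpos.ne']
        positivity
      · have hd' : (0 : ℝ) < d := by exact_mod_cast hdpos
        have h1 := ih N (L - d) (d * lam) (fun n => a (n + d) - a n) (fun j => H (j + 1)) hN
          (by omega) (by positivity) (fun j hj => hH (j + 1) (by omega)) (fun n hn => by
            rw [fwdDiff_iter_shift_sub]
            constructor
            · rw [← nsmul_eq_mul]
              simpa using Finset.card_nsmul_le_sum (Finset.range d) _ lam fun j hj =>
                (ha (n + j) (by have := Finset.mem_range.1 hj; omega)).1
            · rw [show C * (d * lam) = d * (C * lam) by ring, ← nsmul_eq_mul]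
              simpa using Finset.sum_le_card_nsmul (Finset.range d) _ (C * lam) fun j hj =>
                (ha (n + j) (by have := Finset.mem_range.1 hj; omega)).2)
        have h2 : f d = x d := by simp only [hf, if_neg hdpos.ne']
        rw [h2]
        refine h1.trans ?_
        rw [show d * lam * ∏ j ∈ Finset.range q, H (j + 1) = d * P by rw [hP]; ring]
        have h3 : 1 / (N * √(d * P)) = 1 / (N * √P) * (1 / √d) := by
          rw [sqrt_mul hd'.le]
          field_simp
        rw [h3]
        have h4 : (d : ℝ) ≤ H 0 := by
          have : (d : ℝ) ≤ h := by exact_mod_cast hd.le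
          linarith
        gcongr
    have hhpos : (0 : ℝ) < h := by linarith
    have hH0pos : 0 < H 0 := by linarith
    have hsH : 0 < √(H 0) := sqrt_pos.2 hH0pos
    have hsP : 0 < √P := sqrt_pos.2 hPpos
    have havg : ((∑ d ∈ Finset.range h, f d) / h) ^ Q ≤
        B * (E + √(H 0 * P) + 4 * (1 / (N * √(H 0 * P)))) := by
      refine (pow_div_le_sum_pow_div hf0 (by omega) hQpos).trans ?_
      rw [div_le_iff₀ hhpos]
      refine (Finset.sum_le_sum hfd).trans ?_
      rw [← Finset.mul_sum, Finset.sum_add_distrib, Finset.sum_const, Finset.card_range,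
        nsmul_eq_mul, ← Finset.mul_sum, mul_assoc]
      refine mul_le_mul_of_nonneg_left ?_ (by linarith)
      have h1 : ∑ d ∈ Finset.range h, 1 / √(d : ℝ) ≤ 2 * √(h : ℝ) :=
        (Finset.sum_le_sum_of_subset_of_nonneg (Finset.range_mono (by omega : h ≤ h + 1))
          fun _ _ _ => by positivity).trans (sum_range_one_div_sqrt_le h)
      have h2 : 2 * √(h : ℝ) ≤ 4 * (h / √(H 0)) := by
        have e1 : √(H 0) ≤ 2 * √(h : ℝ) := by
          rw [sqrt_le_iff]
          refine ⟨by positivity, ?_⟩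
          rw [mul_pow, sq_sqrt hhpos.le]
          linarith
        rw [← mul_div_assoc, le_div_iff₀ hsH]
        have e2 : √(h : ℝ) * √(h : ℝ) = h := mul_self_sqrt hhpos.le
        nlinarith [sqrt_nonneg (h : ℝ)]
      have h3 : 1 / (N * √P) * ∑ d ∈ Finset.range h, 1 / √(d : ℝ) ≤
          4 * (1 / (N * √(H 0 * P))) * h := by
        calc _ ≤ 1 / (N * √P) * (4 * (h / √(H 0))) := by
              gcongr
              exact h1.trans h2
          _ = _ := by
              rw [sqrt_mul hH0pos.le]
              field_simp
      linarith
    have hX2 : X ^ 2 ≤ 4 * (1 / h + (∑ d ∈ Finset.range h, f d) / h) := by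
      rw [← add_div, ← mul_div_assoc, le_div_iff₀ hhpos, mul_comm]
      linarith
    have hinv : 1 / (h : ℝ) ≤ 2 * (1 / H 0) := by
      rw [mul_one_div, div_le_div_iff₀ hhpos hH0pos]
      linarith
    have hfs : 0 ≤ ∑ d ∈ Finset.range h, f d := Finset.sum_nonneg fun d _ => hf0 d
    rw [hEeq, hPeq, pow_succ' 2 q, pow_mul, ← hQ]
    have hT : 0 < 1 / (N * √(H 0 * P)) := by positivity
    have hR : 0 ≤ (1 / H 0) ^ Q := by positivity
    have hS := sqrt_nonneg (H 0 * P)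
    have hB0 : 0 ≤ B := by linarith
    have hu : 0 ≤ 1 / (h : ℝ) := by positivity
    have hY : 0 ≤ (∑ d ∈ Finset.range h, f d) / h := div_nonneg hfs hhpos.le
    have hR1 : 0 ≤ 1 / H 0 := by positivity
    exact pow_le_of_le_four_mul_add hQpos hu hY hR1 hE0 hS hT.le hB0 (sq_nonneg X) hX2 hinv havg

theorem exists_fwdDiff_iter_eq {F : ℕ → ℝ → ℝ}
    (hF : ∀ j x, 0 < x → HasDerivAt (F j) (F (j + 1) x) x) (m : ℕ) {x : ℝ} (hx : 0 < x) :
    ∃ ξ ∈ Set.Icc x (x + m), (fwdDiff 1)^[m] (F 0) x = F m ξ := by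
  induction m generalizing F with
  | zero => exact ⟨x, by simp, rfl⟩
  | succ m ih =>
    have hG : ∀ j y, 0 < y → HasDerivAt (fun y => F j (y + 1) - F j y)
        (F (j + 1) (y + 1) - F (j + 1) y) y := fun j y hy =>
      ((hF j (y + 1) (by linarith)).comp_add_const y 1).sub (hF j y hy)
    obtain ⟨ξ, hξ, h⟩ := ih (F := fun j y => F j (y + 1) - F j y) hG
    have hξ0 : 0 < ξ := hx.trans_le hξ.1
    obtain ⟨η, hη, h2⟩ := exists_hasDerivAt_eq_slope (F m) (F (m + 1)) (a := ξ) (b := ξ + 1)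
      (by linarith)
      (fun y hy => (hF m y (hξ0.trans_le hy.1)).continuousAt.continuousWithinAt)
      (fun y hy => hF m y (hξ0.trans hy.1))
    refine ⟨η, ⟨by linarith [hξ.1, hη.1], ?_⟩, ?_⟩
    · push_cast
      linarith [hξ.2, hη.2]
    · rw [Function.iterate_succ_apply, h2]
      simp only [add_sub_cancel_left, div_one]
      exact h

theorem hasDerivAt_descPochhammer_mul_rpow (α c : ℝ) (j : ℕ) {x : ℝ} (hx : 0 < x) :
    HasDerivAt (fun y => c * (∏ i ∈ Finset.range j, (α - i)) * y ^ (α - j))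
      (c * (∏ i ∈ Finset.range (j + 1), (α - i)) * x ^ (α - (j + 1 : ℕ))) x := by
  have h := (hasDerivAt_rpow_const (p := α - j) (Or.inl hx.ne')).const_mul
    (c * ∏ i ∈ Finset.range j, (α - i))
  refine h.congr_deriv ?_
  rw [Finset.prod_range_succ]
  push_cast
  rw [show α - ((j : ℝ) + 1) = α - j - 1 by ring]
  ring

theorem fwdDiff_iter_natCast_add (f : ℝ → ℝ) (N : ℝ) (m n : ℕ) :
    (fwdDiff 1)^[m] (fun n : ℕ => f (N + n)) n = (fwdDiff 1)^[m] f (N + n) := by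
  induction m generalizing n with
  | zero => rfl
  | succ m ih =>
    simp only [Function.iterate_succ_apply', fwdDiff, ih]
    push_cast
    rw [add_assoc]

theorem exists_fwdDiff_iter_rpow_bounds {α : ℝ} (hα : ∀ j : ℕ, α ≠ j) {m : ℕ} (hm : α < m) :
    ∃ s c C : ℝ, (s = 1 ∨ s = -1) ∧ 0 < c ∧ 1 ≤ C ∧ ∀ (N n : ℕ) (k : ℝ), 0 < N → n < N → 0 < k →
      c * k * (N : ℝ) ^ (α - m) ≤ (fwdDiff 1)^[m] (fun n : ℕ => s * (k * ((N : ℝ) + n) ^ α)) n ∧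
      (fwdDiff 1)^[m] (fun n : ℕ => s * (k * ((N : ℝ) + n) ^ α)) n ≤
        C * (c * k * (N : ℝ) ^ (α - m)) := by
  set p : ℝ := ∏ i ∈ Finset.range m, (α - i) with hp
  have hp0 : p ≠ 0 := Finset.prod_ne_zero_iff.2 fun i _ => sub_ne_zero.2 (hα i)
  obtain ⟨s, hs, hsp⟩ : ∃ s : ℝ, (s = 1 ∨ s = -1) ∧ s * p = |p| := by
    rcases le_total 0 p with h | h
    · exact ⟨1, Or.inl rfl, by rw [one_mul, abs_of_nonneg h]⟩
    · exact ⟨-1, Or.inr rfl, by rw [abs_of_nonpos h]; ring⟩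
  have hw : (0 : ℝ) < m + 2 := by positivity
  refine ⟨s, |p| * (m + 2 : ℝ) ^ (α - m), (m + 2 : ℝ) ^ (m - α), hs, ?_, ?_, ?_⟩
  · positivity
  · exact one_le_rpow (by linarith [(Nat.cast_nonneg m : (0 : ℝ) ≤ m)]) (by linarith)
  intro N n k hN hn hk
  have hN' : (0 : ℝ) < N := by exact_mod_cast hN
  have hn' : (n : ℝ) < N := by exact_mod_cast hn
  have hN1 : (1 : ℝ) ≤ N := by exact_mod_cast hN
  have hx : (0 : ℝ) < N + n := by positivity
  obtain ⟨ξ, hξ, h⟩ := exists_fwdDiff_iter_eq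
    (fun j x hx => hasDerivAt_descPochhammer_mul_rpow α (s * k) j hx) m hx
  have h1 := fwdDiff_iter_natCast_add (fun y => s * (k * y ^ α)) N m n
  have h2 : (fun y : ℝ => s * k * (∏ i ∈ Finset.range 0, (α - i)) * y ^ (α - (0 : ℕ))) =
      fun y => s * (k * y ^ α) := by
    funext y; simp [mul_assoc]
  rw [h2] at h
  rw [h1, h, ← hp, show s * k * p * ξ ^ (α - m) = (s * p) * k * ξ ^ (α - m) by ring, hsp]
  have hnn : (0 : ℝ) ≤ n := Nat.cast_nonneg n
  have hmm : (0 : ℝ) ≤ m := Nat.cast_nonneg m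
  have hξN : (N : ℝ) ≤ ξ := by linarith [hξ.1]
  have hξN2 : ξ ≤ (m + 2) * N := by
    have := hξ.2
    nlinarith
  have hpos : 0 < |p| := abs_pos.2 hp0
  constructor
  · calc |p| * (m + 2 : ℝ) ^ (α - m) * k * (N : ℝ) ^ (α - m)
        = |p| * k * (((m + 2 : ℝ) * N) ^ (α - m)) := by
          rw [mul_rpow hw.le hN'.le]; ring
      _ ≤ _ := by
          gcongr ?_ * ?_
          exact rpow_le_rpow_of_nonpos (hN'.trans_le hξN) hξN2 (by linarith)
  · calc |p| * k * ξ ^ (α - m) ≤ |p| * k * (N : ℝ) ^ (α - m) := by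
          gcongr ?_ * ?_
          exact rpow_le_rpow_of_nonpos hN' hξN (by linarith)
      _ = _ := by
          have : (m + 2 : ℝ) ^ (m - α) * (m + 2 : ℝ) ^ (α - m) = 1 := by
            rw [← rpow_add hw]; simp
          linear_combination (-(|p| * k * (N : ℝ) ^ (α - m))) * this

theorem norm_sum_addChar_sign_mul {s : ℝ} (hs : s = 1 ∨ s = -1) (a : ℕ → ℝ) (L : ℕ) :
    ‖∑ n ∈ Finset.range L, addChar (s * a n)‖ = ‖∑ n ∈ Finset.range L, addChar (a n)‖ := by
  rcases hs with rfl | rfl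
  · simp
  · rw [← RCLike.norm_conj, map_sum]
    simp [conj_addChar]

theorem prod_range_inv_pow_two_pow (u R : ℝ) (hu : u ≠ 0) (q : ℕ) :
    u ^ (2 * 2 ^ (q + 1)) * ∏ j ∈ Finset.range (q + 1),
      ((if j = 0 then R else 1) * (u ^ (2 ^ (j + 1)))⁻¹) = R * u ^ 2 := by
  induction q with
  | zero => simp; field_simp
  | succ q ih =>
    rw [Finset.prod_range_succ, if_neg (by omega), ← ih,
      show 2 * 2 ^ (q + 1 + 1) = 2 * 2 ^ (q + 1) + 2 ^ (q + 1 + 1) by ring, pow_add]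
    field_simp

theorem exists_norm_sum_addChar_le_of_params (q : ℕ) {C c : ℝ} (hC : 1 ≤ C) (hc : 0 < c) :
    ∃ B : ℝ, 0 < B ∧ ∀ (N L : ℕ) (lam D u R G : ℝ) (a : ℕ → ℝ), 0 < N → L ≤ N → 0 < lam →
      0 < D → D ≤ u → u ≤ 1 → 1 ≤ R → 0 < G →
      lam * R * D ^ 2 = c * G * u → G ≤ D ^ (4 * 2 ^ (q + 1) - 1) → 1 ≤ N ^ 2 * G * D →
      1 ≤ N * D ^ 2 ^ (q + 1) → R ≤ N * D ^ 2 →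
      (∀ n < L, lam ≤ (fwdDiff 1)^[q + 1 + 2] a n ∧ (fwdDiff 1)^[q + 1 + 2] a n ≤ C * lam) →
      ‖∑ n ∈ Finset.range L, addChar (a n)‖ ≤ B * (N * u) := by
  obtain ⟨B, hB, hmain⟩ := exists_pow_norm_sum_addChar_le (q + 1) hC
  have hsc : 0 < √c := sqrt_pos.2 hc
  refine ⟨B * ((q + 1 : ℕ) + √c + 1 / √c), by positivity, ?_⟩
  intro N L lam D u R G a hN hL hlam hD hDu hu1 hR hG hlamR hG1 hG2 hND hRN ha
  obtain ⟨Q, hQ⟩ : ∃ Q, Q = 2 ^ (q + 1) := ⟨_, rfl⟩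
  have hQ2 : 2 ≤ Q := by
    rw [hQ, pow_succ]
    have : 0 < 2 ^ q := by positivity
    omega
  have hN' : (0 : ℝ) < N := by exact_mod_cast hN
  have hu : 0 < u := hD.trans_le hDu
  set H : ℕ → ℝ := fun j => (if j = 0 then R else 1) * (u ^ (2 ^ (j + 1)))⁻¹ with hH
  have hif : ∀ j, 1 ≤ (if j = 0 then R else 1) := fun j => by split_ifs <;> simp [hR]
  have hHj : ∀ j < q + 1, 1 ≤ H j ∧ H j ≤ N := by
    intro j hj
    constructor
    · exact one_le_mul_of_one_le_of_one_le (hif j)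
        ((one_le_inv₀ (by positivity)).2 (pow_le_one₀ hu.le hu1))
    · simp only [hH]
      rw [← div_eq_mul_inv, div_le_iff₀ (by positivity)]
      rcases Nat.eq_zero_or_pos j with rfl | hj0
      · simp only [if_true]
        refine hRN.trans ?_
        simp only [zero_add, pow_one]
        gcongr
      · rw [if_neg hj0.ne']
        refine hND.trans ?_
        gcongr ?_ * ?_
        calc D ^ 2 ^ (q + 1) ≤ u ^ 2 ^ (q + 1) := pow_le_pow_left₀ hD.le hDu _
          _ ≤ u ^ 2 ^ (j + 1) := pow_le_pow_of_le_one hu.le hu1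
              (Nat.pow_le_pow_right (by norm_num) (by omega))
  have h1 := hmain N L lam a H hN hL hlam hHj ha
  set P := ∏ j ∈ Finset.range (q + 1), H j with hP
  have hPe : u ^ (2 * Q) * P = R * u ^ 2 := by
    rw [hQ]; exact prod_range_inv_pow_two_pow u R hu.ne' q
  have hS : ∑ j ∈ Finset.range (q + 1), (1 / H j) ^ (2 ^ (q + 1 - 1 - j)) ≤ (q + 1 : ℕ) * u ^ Q := by
    have : ∀ j ∈ Finset.range (q + 1), (1 / H j) ^ (2 ^ (q + 1 - 1 - j)) ≤ u ^ Q := by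
      intro j hj
      rw [Finset.mem_range] at hj
      have hj2 : 1 / H j ≤ u ^ (2 ^ (j + 1)) := by
        simp only [hH]
        rw [one_div, mul_inv, inv_inv]
        exact mul_le_of_le_one_left (by positivity) (inv_le_one_of_one_le₀ (hif j))
      have hHpos : 0 < H j := by linarith [(hHj j hj).1]
      calc _ ≤ (u ^ (2 ^ (j + 1))) ^ (2 ^ (q + 1 - 1 - j)) := pow_le_pow_left₀ (by positivity) hj2 _
        _ = u ^ Q := by
          rw [← pow_mul, ← pow_add, hQ]
          congr 2
          omega
    refine (Finset.sum_le_sum this).trans ?_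
    simp
  have hPpos : 0 < P := Finset.prod_pos fun j hj => by
    linarith [(hHj j (Finset.mem_range.1 hj)).1]
  have hkey : u ^ (2 * Q) * (lam * P) * D ^ 2 = c * G * u ^ 3 := by
    linear_combination (lam * D ^ 2) * hPe + u ^ 2 * hlamR
  have hup : √(lam * P) ≤ √c * u ^ Q := by
    rw [sqrt_le_iff]
    refine ⟨by positivity, ?_⟩
    rw [mul_pow, sq_sqrt hc.le, ← pow_mul, mul_comm Q 2]
    have h3 : G ≤ D ^ 2 * u ^ (4 * Q - 3) := by
      rw [← hQ] at hG1
      refine hG1.trans ?_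
      rw [show 4 * Q - 1 = 2 + (4 * Q - 3) by omega, pow_add]
      gcongr
    have h4 : u ^ (2 * Q) * D ^ 2 * (lam * P) ≤ u ^ (2 * Q) * D ^ 2 * (c * u ^ (2 * Q)) := by
      calc _ = c * G * u ^ 3 := by linarith
        _ ≤ c * (D ^ 2 * u ^ (4 * Q - 3)) * u ^ 3 := by gcongr
        _ = c * D ^ 2 * u ^ (4 * Q - 3 + 3) := by rw [pow_add]; ring
        _ = _ := by
          rw [show 4 * Q - 3 + 3 = 2 * Q + 2 * Q by omega, pow_add]; ring
    exact le_of_mul_le_mul_left h4 (by positivity)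
  have hlow : 1 / (N * √(lam * P)) ≤ 1 / √c * u ^ Q := by
    have h5 : √c ≤ u ^ Q * (N * √(lam * P)) := by
      rw [← sqrt_sq (by positivity : 0 ≤ u ^ Q * (N * √(lam * P)))]
      apply sqrt_le_sqrt
      rw [mul_pow, mul_pow, sq_sqrt (by positivity), ← pow_mul, mul_comm Q 2]
      have h6 : D ^ 2 * c ≤ D ^ 2 * (u ^ (2 * Q) * (N ^ 2 * (lam * P))) := by
        calc D ^ 2 * c ≤ D ^ 2 * c * (N ^ 2 * G * D) := le_mul_of_one_le_right (by positivity) hG2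
          _ = c * G * N ^ 2 * D ^ 3 := by ring
          _ ≤ c * G * N ^ 2 * u ^ 3 := by gcongr
          _ = _ := by linear_combination (-(N : ℝ) ^ 2) * hkey
      exact le_of_mul_le_mul_left h6 (by positivity)
    rw [one_div_mul_eq_div, div_le_div_iff₀ (by positivity) hsc]
    linarith
  set E := ((q + 1 : ℕ) + √c + 1 / √c : ℝ) with hE
  have hE1 : 1 ≤ E := by
    have : (1 : ℝ) ≤ (q + 1 : ℕ) := by exact_mod_cast (by omega)
    have : 0 < 1 / √c := by positivity
    linarith
  have h7 : (‖∑ n ∈ Finset.range L, addChar (a n)‖ / N) ^ Q ≤ (B * E * u) ^ Q := by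
    rw [hQ]
    refine h1.trans ?_
    rw [← hQ]
    calc _ ≤ B * ((q + 1 : ℕ) * u ^ Q + √c * u ^ Q + 1 / √c * u ^ Q) := by gcongr
      _ = B * E * u ^ Q := by rw [hE]; ring
      _ ≤ (B * E) ^ Q * u ^ Q := by
        gcongr
        exact le_self_pow₀ (one_le_mul_of_one_le_of_one_le hB hE1) (by omega)
      _ = _ := (mul_pow _ _ _).symm
  have h8 := le_of_pow_le_pow_left₀ (by omega) (by positivity) h7
  rw [div_le_iff₀ hN'] at h8
  linarith

theorem one_le_rpow_mul_rpow {x a b : ℝ} (hx : 1 ≤ x) (h : 0 ≤ a + b) : 1 ≤ x ^ a * x ^ b := by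
  rw [← rpow_add (by linarith)]
  exact one_le_rpow hx h

theorem norm_sum_addChar_le_of_one_le (a : ℕ → ℝ) {N L : ℕ} (hL : L ≤ N) {u : ℝ} (hu : 1 ≤ u) :
    ‖∑ n ∈ Finset.range L, addChar (a n)‖ ≤ N * u := by
  have h := norm_sum_addChar_le_card a (Finset.range L)
  rw [Finset.card_range] at h
  have hL' : (L : ℝ) ≤ N := by exact_mod_cast hL
  have hN : (0 : ℝ) ≤ N := Nat.cast_nonneg N
  nlinarith

theorem exists_norm_sum_addChar_rpow_le_of_three_le (q : ℕ) {α σ : ℝ} (hα : ∀ j : ℕ, α ≠ j)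
    (hm : α < (q + 1 + 2 : ℕ)) (hσ : 0 < σ) (h1 : σ * (2 * 2 ^ (q + 1)) ≤ 1)
    (h2 : σ * (4 * 2 ^ (q + 1) - 1) ≤ (q + 1 + 2 : ℕ) - α) (h3 : (q + 1 + 2 : ℕ) - α ≤ 2 - σ) :
    ∃ B : ℝ, 0 < B ∧ ∀ N L k : ℕ, 0 < N → L ≤ N → 0 < k →
      ‖∑ n ∈ Finset.range L, addChar (k * ((N : ℝ) + n) ^ α)‖ ≤
        B * (N * ((N : ℝ) ^ (-σ) * max 1 (k * (N : ℝ) ^ (-σ)))) := by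
  obtain ⟨s, c, C, hs, hc, hC, hder⟩ := exists_fwdDiff_iter_rpow_bounds hα hm
  obtain ⟨B, hB, hmain⟩ := exists_norm_sum_addChar_le_of_params q hC hc
  refine ⟨max 1 B, by positivity, ?_⟩
  intro N L k hN hL hk
  have hN' : (0 : ℝ) < N := by exact_mod_cast hN
  have hN1 : (1 : ℝ) ≤ N := by exact_mod_cast hN
  have hk' : (0 : ℝ) < k := by exact_mod_cast hk
  have hk1 : (1 : ℝ) ≤ k := by exact_mod_cast hk
  set D : ℝ := (N : ℝ) ^ (-σ) with hDdef
  have hD : 0 < D := by positivity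
  have hD1 : D ≤ 1 := rpow_le_one_of_one_le_of_nonpos hN1 (by linarith)
  set ρ : ℝ := max 1 (k * D) with hρ
  have hρ1 : 1 ≤ ρ := le_max_left _ _
  have hρk : k * D ≤ ρ := le_max_right _ _
  rcases le_or_gt 1 (D * ρ) with hu | hu
  · refine (norm_sum_addChar_le_of_one_le _ hL hu).trans ?_
    exact le_mul_of_one_le_left (by positivity) (le_max_left _ _)
  have hDpow : ∀ j : ℕ, D ^ j = (N : ℝ) ^ (-σ * j) := fun j => by
    rw [hDdef, ← rpow_natCast, ← rpow_mul hN'.le]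
  have hQ : (2 : ℝ) ≤ 2 ^ (q + 1) := by
    rw [pow_succ]
    linarith [one_le_pow₀ (by norm_num : (1 : ℝ) ≤ 2) (n := q)]
  have hNat : ((4 * 2 ^ (q + 1) - 1 : ℕ) : ℝ) = 4 * 2 ^ (q + 1) - 1 := by
    rw [Nat.cast_sub (by have : 0 < 2 ^ (q + 1) := by positivity
                         omega)]
    push_cast; rfl
  have h := hmain N L (c * k * (N : ℝ) ^ (α - (q + 1 + 2 : ℕ))) D (D * ρ) (D * ρ / (k * D ^ 2))
    ((N : ℝ) ^ (α - (q + 1 + 2 : ℕ))) (fun n => s * (k * ((N : ℝ) + n) ^ α)) hN hL (by positivity)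
    hD (le_mul_of_one_le_right hD.le hρ1) hu.le ?_ (by positivity) ?_ ?_ ?_ ?_ ?_ ?_
  · rw [norm_sum_addChar_sign_mul hs] at h
    refine h.trans ?_
    gcongr
    exact le_max_right _ _
  · rw [le_div_iff₀ (by positivity)]
    nlinarith
  · field_simp
  · rw [hDpow, hNat]
    exact rpow_le_rpow_of_exponent_le hN1 (by linarith)
  · rw [← rpow_natCast (N : ℝ) 2, hDdef, ← rpow_add hN', ← rpow_add hN']
    refine one_le_rpow hN1 ?_
    push_cast at h3 ⊢
    linarith
  · rw [hDpow, ← rpow_one_add' hN'.le]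
    · refine one_le_rpow hN1 ?_
      push_cast
      nlinarith
    · push_cast
      nlinarith
  · have h4 : 1 ≤ N * D ^ 3 := by
      rw [hDpow]
      nth_rewrite 1 [← rpow_one (N : ℝ)]
      refine one_le_rpow_mul_rpow hN1 ?_
      push_cast
      nlinarith
    rw [div_le_iff₀ (by positivity)]
    have h5 : D * ρ ≤ k * D := by
      rw [hρ, mul_max_of_nonneg _ _ hD.le]
      refine max_le (by nlinarith) ?_
      nlinarith [mul_pos hk' hD]
    calc D * ρ ≤ k * D := h5
      _ ≤ k * D * (N * D ^ 3) := le_mul_of_one_le_right (by positivity) h4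
      _ = _ := by ring
  · intro n hn
    exact hder N n k hN (by omega) hk'

theorem exists_norm_sum_addChar_rpow_le_of_two {α σ : ℝ} (hα : ∀ j : ℕ, α ≠ j)
    (hm : α < 2) (h1 : 3 * σ ≤ 2 - α) (h2 : 2 * σ ≤ α) :
    ∃ B : ℝ, 0 < B ∧ ∀ N L k : ℕ, 0 < N → L ≤ N → 0 < k →
      ‖∑ n ∈ Finset.range L, addChar (k * ((N : ℝ) + n) ^ α)‖ ≤
        B * (N * ((N : ℝ) ^ (-σ) * max 1 (k * (N : ℝ) ^ (-σ)))) := by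
  obtain ⟨s, c, C, hs, hc, hC, hder⟩ :=
    exists_fwdDiff_iter_rpow_bounds hα (m := 2) (by exact_mod_cast hm)
  have hsc : 0 < √c := sqrt_pos.2 hc
  refine ⟨8 * C * (√c + 1 / √c), by positivity, ?_⟩
  intro N L k hN hL hk
  have hN' : (0 : ℝ) < N := by exact_mod_cast hN
  have hN1 : (1 : ℝ) ≤ N := by exact_mod_cast hN
  have hk' : (0 : ℝ) < k := by exact_mod_cast hk
  have hk1 : (1 : ℝ) ≤ k := by exact_mod_cast hk
  have hL' : (L : ℝ) ≤ N := by exact_mod_cast hL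
  set D : ℝ := (N : ℝ) ^ (-σ) with hDdef
  have hD : 0 < D := by positivity
  set ρ : ℝ := max 1 (k * D) with hρ
  have hρ1 : 1 ≤ ρ := le_max_left _ _
  have hρk : k * D ≤ ρ := le_max_right _ _
  have hDpow : ∀ j : ℕ, D ^ j = (N : ℝ) ^ (-σ * j) := fun j => by
    rw [hDdef, ← rpow_natCast, ← rpow_mul hN'.le]
  have h := norm_sum_addChar_le_of_fwdDiff_two hC
    (by positivity : 0 < c * k * (N : ℝ) ^ (α - (2 : ℕ)))
    (a := fun n => s * (k * ((N : ℝ) + n) ^ α)) (L := L)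
    (fun n hn => hder N n k hN (by omega) hk')
  rw [norm_sum_addChar_sign_mul hs] at h
  set G : ℝ := (N : ℝ) ^ (α - (2 : ℕ)) with hG
  have hGpos : 0 < G := by positivity
  have hGD : G ≤ D ^ 3 := by
    rw [hDpow, hG]
    refine rpow_le_rpow_of_exponent_le hN1 ?_
    push_cast
    linarith
  have hup : √(c * k * G) ≤ √c * (D * ρ) := by
    rw [sqrt_le_iff]
    refine ⟨by positivity, ?_⟩
    rw [mul_pow, sq_sqrt hc.le, mul_assoc]
    gcongr
    calc k * G ≤ k * D ^ 3 := by gcongr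
      _ = D ^ 2 * (k * D) := by ring
      _ ≤ D ^ 2 * (ρ * ρ) := by
        exact mul_le_mul_of_nonneg_left
          (hρk.trans (le_mul_of_one_le_left (by positivity) hρ1)) (by positivity)
      _ = _ := by ring
  have hlow : 1 / √(c * k * G) ≤ 1 / √c * (N * (D * ρ)) := by
    rw [one_div_mul_eq_div, div_le_div_iff₀ (by positivity) hsc, one_mul,
      ← sqrt_sq (by positivity : 0 ≤ N * (D * ρ)), ← sqrt_mul (by positivity)]
    apply sqrt_le_sqrt
    have h3 : 1 ≤ N ^ 2 * D ^ 2 * G := by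
      rw [hDpow, hG, ← rpow_natCast (N : ℝ) 2, ← rpow_add hN']
      refine one_le_rpow_mul_rpow hN1 ?_
      push_cast
      linarith
    calc c = c * (1 * 1 * 1) := by ring
      _ ≤ c * (N ^ 2 * D ^ 2 * G * ρ ^ 2 * k) := by
        gcongr
        exact one_le_pow₀ hρ1
      _ = _ := by ring
  calc _ ≤ 8 * C * (L * √(c * k * G) + 1 / √(c * k * G)) := h
    _ ≤ 8 * C * (N * (√c * (D * ρ)) + 1 / √c * (N * (D * ρ))) := by gcongr
    _ = _ := by ring

theorem fract_sub_half_ge (x : ℝ) {δ : ℝ} (hδ : 0 < δ) (hδ1 : δ ≤ 1) :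
    (Int.fract (x + δ) ^ 2 - Int.fract (x + δ) - (Int.fract x ^ 2 - Int.fract x)) / (2 * δ) -
      δ / 2 ≤ Int.fract x - 1 / 2 := by
  have h0 := Int.fract_nonneg x
  have h1 := Int.fract_lt_one x
  have hx := Int.self_sub_floor x
  rw [sub_le_iff_le_add, div_le_iff₀ (by positivity)]
  rcases lt_or_ge (Int.fract x + δ) 1 with h | h
  · have : Int.fract (x + δ) = Int.fract x + δ :=
      Int.fract_eq_iff.2 ⟨by positivity, h, ⌊x⌋, by linarith⟩
    rw [this]
    nlinarith
  · have : Int.fract (x + δ) = Int.fract x + δ - 1 :=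
      Int.fract_eq_iff.2 ⟨by linarith, by linarith, ⌊x⌋ + 1, by push_cast; linarith⟩
    rw [this]
    nlinarith

theorem fract_sub_half_le (x : ℝ) {δ : ℝ} (hδ : 0 < δ) (hδ1 : δ ≤ 1) :
    Int.fract x - 1 / 2 ≤ -(Int.fract (x + -δ) ^ 2 - Int.fract (x + -δ) -
      (Int.fract x ^ 2 - Int.fract x)) / (2 * δ) + δ / 2 := by
  have h0 := Int.fract_nonneg x
  have h1 := Int.fract_lt_one x
  have hx := Int.self_sub_floor x
  rw [← sub_le_iff_le_add, le_div_iff₀ (by positivity)]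
  rcases lt_or_ge (Int.fract x) δ with h | h
  · have : Int.fract (x + -δ) = Int.fract x - δ + 1 :=
      Int.fract_eq_iff.2 ⟨by linarith, by linarith, ⌊x⌋ - 1, by push_cast; linarith⟩
    rw [this]
    nlinarith
  · have : Int.fract (x + -δ) = Int.fract x - δ :=
      Int.fract_eq_iff.2 ⟨by linarith, by linarith, ⌊x⌋, by linarith⟩
    rw [this]
    nlinarith

theorem hasSum_cos_fract (x : ℝ) :
    HasSum (fun k : ℕ => 1 / (k : ℝ) ^ 2 * cos (2 * π * (k * x)))
      (π ^ 2 * (Int.fract x ^ 2 - Int.fract x + 1 / 6)) := by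
  have h := hasSum_one_div_nat_pow_mul_cos (k := 1) one_ne_zero (x := Int.fract x)
    ⟨Int.fract_nonneg x, (Int.fract_lt_one x).le⟩
  convert h using 1
  · funext k
    have h1 : 2 * π * (k * x) = 2 * π * k * Int.fract x + ((k * ⌊x⌋ : ℤ) : ℝ) * (2 * π) := by
      have := Int.self_sub_floor x
      push_cast
      rw [← this]; ring
    rw [h1, cos_add_int_mul_two_pi]
  · have : (Polynomial.map (algebraMap ℚ ℝ) (Polynomial.bernoulli (2 * 1))).eval (Int.fract x) =
        Int.fract x ^ 2 - Int.fract x + 1 / 6 := by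
      rw [Polynomial.eval_map_algebraMap]
      simp [Polynomial.bernoulli, Finset.sum_range_succ, bernoulli_one, bernoulli_two]
      ring
    rw [this]
    simp only [Nat.factorial]
    push_cast
    ring

theorem re_addChar (x : ℝ) : (addChar x).re = cos (2 * π * x) := by
  rw [addChar, Complex.exp_ofReal_mul_I_re]

theorem norm_addChar_sub_one_le (x : ℝ) : ‖addChar x - 1‖ ≤ 2 * π * min 1 |x| := by
  rw [mul_min_of_nonneg _ _ (by positivity)]
  refine le_min ?_ ?_
  · calc ‖addChar x - 1‖ ≤ ‖addChar x‖ + ‖(1 : ℂ)‖ := norm_sub_le _ _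
      _ ≤ 2 * π * 1 := by
        rw [norm_addChar, norm_one]
        linarith [pi_gt_three]
  · have := Real.norm_exp_I_mul_ofReal_sub_one_le (x := 2 * π * x)
    rw [addChar, mul_comm _ Complex.I]
    refine this.trans ?_
    rw [norm_mul, Real.norm_of_nonneg (by positivity : 0 ≤ 2 * π), Real.norm_eq_abs]

theorem abs_sum_fract_sq_sub_le (x : ℕ → ℝ) (L : ℕ) (η : ℝ) {w : ℕ → ℝ} (hw : Summable w)
    (h : ∀ k : ℕ, ‖∑ n ∈ Finset.range L, addChar (k * x n)‖ * min 1 (k * |η|) / (k : ℝ) ^ 2 ≤ w k) :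
    |∑ n ∈ Finset.range L, (Int.fract (x n + η) ^ 2 - Int.fract (x n + η) -
      (Int.fract (x n) ^ 2 - Int.fract (x n)))| ≤ 2 / π * ∑' k, w k := by
  have h1 : HasSum (fun k : ℕ => 1 / (k : ℝ) ^ 2 * ((addChar (k * η) - 1) *
      ∑ n ∈ Finset.range L, addChar (k * x n)).re)
      (π ^ 2 * ∑ n ∈ Finset.range L, (Int.fract (x n + η) ^ 2 - Int.fract (x n + η) -
        (Int.fract (x n) ^ 2 - Int.fract (x n)))) := by
    have h2 := hasSum_sum (s := Finset.range L) fun n _ =>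
      (hasSum_cos_fract (x n + η)).sub (hasSum_cos_fract (x n))
    convert! h2 using 1
    · funext k
      rw [Finset.mul_sum, Complex.re_sum, Finset.mul_sum]
      refine Finset.sum_congr rfl fun n _ => ?_
      rw [sub_mul, one_mul, ← addChar_add, Complex.sub_re, re_addChar, re_addChar,
        show (k : ℝ) * η + k * x n = k * (x n + η) by ring]
      ring
    · rw [Finset.mul_sum]
      refine Finset.sum_congr rfl fun n _ => ?_
      ring
  have h3 : ∀ k : ℕ, ‖1 / (k : ℝ) ^ 2 * ((addChar (k * η) - 1) *
      ∑ n ∈ Finset.range L, addChar (k * x n)).re‖ ≤ 2 * π * w k := by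
    intro k
    rw [norm_mul, Real.norm_of_nonneg (by positivity : 0 ≤ 1 / (k : ℝ) ^ 2), Real.norm_eq_abs]
    calc _ ≤ 1 / (k : ℝ) ^ 2 * ‖(addChar (k * η) - 1) *
          ∑ n ∈ Finset.range L, addChar (k * x n)‖ := by
          gcongr
          exact Complex.abs_re_le_norm _
      _ ≤ 1 / (k : ℝ) ^ 2 * ((2 * π * min 1 (k * |η|)) *
          ‖∑ n ∈ Finset.range L, addChar (k * x n)‖) := by
          rw [norm_mul]
          gcongr
          have := norm_addChar_sub_one_le (k * η)
          rwa [abs_mul, Nat.abs_cast] at this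
      _ = 2 * π * (‖∑ n ∈ Finset.range L, addChar (k * x n)‖ * min 1 (k * |η|) / (k : ℝ) ^ 2) := by
          ring
      _ ≤ _ := by
        gcongr
        exact h k
  have h4 := tsum_of_norm_bounded (hw.hasSum.mul_left (2 * π)) h3
  rw [h1.tsum_eq, norm_mul, Real.norm_of_nonneg (by positivity : 0 ≤ π ^ 2), Real.norm_eq_abs] at h4
  refine le_of_mul_le_mul_left (h4.trans_eq ?_) (by positivity : 0 < π ^ 2)
  field_simp

theorem abs_sum_fract_sub_half_le (x : ℕ → ℝ) (L : ℕ) {δ : ℝ} (hδ : 0 < δ) (hδ1 : δ ≤ 1)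
    {w : ℕ → ℝ} (hw : Summable w)
    (h : ∀ k : ℕ, ‖∑ n ∈ Finset.range L, addChar (k * x n)‖ * min 1 (k * δ) / (k : ℝ) ^ 2 ≤ w k) :
    |∑ n ∈ Finset.range L, (Int.fract (x n) - 1 / 2)| ≤ L * δ + (∑' k, w k) / δ := by
  have hp := abs_sum_fract_sq_sub_le x L δ hw (by rwa [abs_of_pos hδ])
  have hm := abs_sum_fract_sq_sub_le x L (-δ) hw (by rwa [abs_neg, abs_of_pos hδ])
  have hw0 : 0 ≤ ∑' k, w k := tsum_nonneg fun k => le_trans (by positivity) (h k)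
  have hpi : 2 / π * (∑' k, w k) ≤ 2 * ∑' k, w k := by
    gcongr
    rw [div_le_iff₀ pi_pos]
    linarith [pi_gt_three]
  have hL : (0 : ℝ) ≤ L := Nat.cast_nonneg L
  have key : ∀ A : ℝ, |A| ≤ 2 / π * (∑' k, w k) → |A / (2 * δ)| ≤ (∑' k, w k) / δ := by
    intro A hA
    rw [abs_div, abs_of_pos (by positivity : 0 < 2 * δ), div_le_div_iff₀ (by positivity) hδ]
    nlinarith
  have hp' := abs_le.1 (key _ hp)
  have hm' := abs_le.1 (key _ hm)
  rw [Finset.sum_div] at hp' hm'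
  have h5 := Finset.sum_le_sum fun n (_ : n ∈ Finset.range L) => fract_sub_half_ge (x n) hδ hδ1
  have h6 := Finset.sum_le_sum fun n (_ : n ∈ Finset.range L) => fract_sub_half_le (x n) hδ hδ1
  simp only [neg_div] at h6
  rw [Finset.sum_sub_distrib] at h5
  rw [Finset.sum_add_distrib, Finset.sum_neg_distrib] at h6
  simp only [Finset.sum_const, Finset.card_range, nsmul_eq_mul] at h5 h6
  rw [abs_le]
  have hLδ : 0 ≤ L * δ := by positivity
  constructor
  · linarith [hp'.1]
  · linarith [hm'.1]

theorem exists_abs_sum_fract_rpow_sub_half_le {α σ B η : ℝ} (hσ : 0 < σ) (hη : 0 < η) (hη1 : η < 1)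
    (hB : ∀ N L k : ℕ, 0 < N → L ≤ N → 0 < k →
      ‖∑ n ∈ Finset.range L, addChar (k * ((N : ℝ) + n) ^ α)‖ ≤
        B * (N * ((N : ℝ) ^ (-σ) * max 1 (k * (N : ℝ) ^ (-σ))))) :
    ∃ C : ℝ, 0 < C ∧ ∀ N L : ℕ, 0 < N → L ≤ N →
      |∑ n ∈ Finset.range L, (Int.fract (((N : ℝ) + n) ^ α) - 1 / 2)| ≤
        C * (N : ℝ) ^ (1 - σ * (1 - 2 * η)) := by
  have hsum : Summable fun k : ℕ => (k : ℝ) ^ (-1 - η) :=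
    summable_nat_rpow.2 (by linarith)
  set Z := ∑' k : ℕ, (k : ℝ) ^ (-1 - η) with hZ
  have hZ0 : 0 ≤ Z := tsum_nonneg fun k => by positivity
  set B' := max 1 B with hB'
  have hB1 : 1 ≤ B' := le_max_left _ _
  refine ⟨1 + B' * Z, by positivity, ?_⟩
  intro N L hN hL
  have hN' : (0 : ℝ) < N := by exact_mod_cast hN
  have hN1 : (1 : ℝ) ≤ N := by exact_mod_cast hN
  have hL' : (L : ℝ) ≤ N := by exact_mod_cast hL
  set D : ℝ := (N : ℝ) ^ (-σ) with hDdef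
  have hD : 0 < D := by positivity
  have hD1 : D ≤ 1 := rpow_le_one_of_one_le_of_nonpos hN1 (by linarith)
  have hDN : (N : ℝ) * D ^ (1 - 2 * η) = (N : ℝ) ^ (1 - σ * (1 - 2 * η)) := by
    rw [hDdef, ← rpow_mul hN'.le]
    nth_rewrite 1 [← rpow_one (N : ℝ)]
    rw [← rpow_add hN']
    congr 1
    ring
  have hDD : D ≤ D ^ (1 - 2 * η) := by
    nth_rewrite 1 [← rpow_one D]
    exact rpow_le_rpow_of_exponent_ge hD hD1 (by linarith)
  have h := abs_sum_fract_sub_half_le (fun n => ((N : ℝ) + n) ^ α) L hD hD1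
    (hsum.mul_left (B' * (N * D ^ (2 - 2 * η)))) ?_
  · rw [tsum_mul_left, ← hZ] at h
    refine h.trans ?_
    have h1 : D ^ (2 - 2 * η) / D = D ^ (1 - 2 * η) := by
      nth_rewrite 2 [← rpow_one D]
      rw [← rpow_sub hD]
      congr 1
      ring
    calc L * D + B' * (N * D ^ (2 - 2 * η)) * Z / D
        = L * D + B' * Z * (N * (D ^ (2 - 2 * η) / D)) := by ring
      _ ≤ N * D ^ (1 - 2 * η) + B' * Z * (N * D ^ (1 - 2 * η)) := by
        rw [h1]
        gcongr
      _ = _ := by rw [hDN]; ring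
  · intro k
    rcases Nat.eq_zero_or_pos k with rfl | hk
    · simp
      positivity
    have hk' : (0 : ℝ) < k := by exact_mod_cast hk
    set S := ‖∑ n ∈ Finset.range L, addChar (k * ((N : ℝ) + n) ^ α)‖ with hS
    have hS0 : 0 ≤ S := norm_nonneg _
    have hmin0 : 0 ≤ min 1 (k * D) := by positivity
    have h1 : S * min 1 (k * D) ≤ N := by
      have h2 : S ≤ N * 1 := norm_sum_addChar_le_of_one_le _ hL le_rfl
      calc _ ≤ S * 1 := by
            gcongr
            exact min_le_left _ _
        _ ≤ _ := by linarith
    have h2 : S * min 1 (k * D) ≤ B' * (N * D ^ 2 * k) := by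
      have h3 : S ≤ B' * (N * (D * max 1 (k * D))) := by
        refine (hB N L k hN hL hk).trans ?_
        gcongr
        exact le_max_right _ _
      calc _ ≤ B' * (N * (D * max 1 (k * D))) * min 1 (k * D) := by gcongr
        _ = B' * (N * D) * (min 1 (k * D) * max 1 (k * D)) := by ring
        _ = _ := by rw [min_mul_max]; ring
    have h0 : 0 ≤ S * min 1 (k * D) := by positivity
    rw [div_le_iff₀ (by positivity)]
    calc S * min 1 (k * D) = (S * min 1 (k * D)) ^ (1 - η) * (S * min 1 (k * D)) ^ η := by
          rw [← rpow_add' h0 (by simp)]; simp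
      _ ≤ (B' * (N * D ^ 2 * k)) ^ (1 - η) * (N : ℝ) ^ η := by
          gcongr
      _ = B' ^ (1 - η) * ((N : ℝ) ^ (1 - η) * (N : ℝ) ^ η) * (D ^ 2) ^ (1 - η) * k ^ (1 - η) := by
          rw [mul_rpow (by positivity) (by positivity), mul_rpow (by positivity) (by positivity),
            mul_rpow (by positivity) (by positivity)]
          ring
      _ = B' ^ (1 - η) * N * D ^ (2 - 2 * η) * (k ^ (-1 - η) * k ^ 2) := by
          rw [← rpow_add hN', ← rpow_natCast D 2, ← rpow_mul hD.le, ← rpow_natCast (k : ℝ) 2,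
            ← rpow_add hk', sub_add_cancel, rpow_one]
          push_cast
          congr 2
          · congr 1
            ring
          · ring_nf
      _ ≤ B' * N * D ^ (2 - 2 * η) * (k ^ (-1 - η) * k ^ 2) := by
          gcongr
          nth_rewrite 2 [← rpow_one B']
          exact rpow_le_rpow_of_exponent_le hB1 (by linarith)
      _ = _ := by ring

theorem exists_abs_sum_Icc_le_of_dyadic {c : ℕ → ℝ} {C θ : ℝ} (hC : 0 < C) (hθ : 0 < θ)
    (h : ∀ N L : ℕ, 0 < N → L ≤ N → |∑ n ∈ Finset.range L, c (N + n)| ≤ C * (N : ℝ) ^ θ) :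
    ∃ K : ℝ, 0 < K ∧ ∀ n : ℕ, |∑ k ∈ Finset.Icc 1 n, c k| ≤ K * (n : ℝ) ^ θ := by
  set r : ℝ := 2 ^ (-θ) with hr
  have hr1 : r < 1 := rpow_lt_one_of_one_lt_of_neg (by norm_num) (by linarith)
  have hr0 : 0 < 1 - r := by linarith
  refine ⟨C / (1 - r), by positivity, ?_⟩
  intro n
  induction n using Nat.strong_induction_on with
  | _ n ih =>
    rcases Nat.eq_zero_or_pos n with rfl | hn
    · simp
      positivity
    have hn' : (0 : ℝ) < n := by exact_mod_cast hn
    have hsplit : ∑ k ∈ Finset.Icc 1 n, c k = ∑ k ∈ Finset.Icc 1 (n / 2), c k +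
        ∑ k ∈ Finset.range (n - n / 2), c (n / 2 + 1 + k) := by
      rw [← Finset.Ico_add_one_right_eq_Icc, ← Finset.Ico_add_one_right_eq_Icc,
        ← Finset.sum_Ico_consecutive c (by omega : 1 ≤ n / 2 + 1) (by omega : n / 2 + 1 ≤ n + 1),
        Finset.sum_Ico_eq_sum_range c (n / 2 + 1)]
      congr 3
      omega
    have h1 := ih (n / 2) (by omega)
    have h2 := h (n / 2 + 1) (n - n / 2) (by omega) (by omega)
    have h3 : ((n / 2 : ℕ) : ℝ) ^ θ ≤ r * (n : ℝ) ^ θ := by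
      calc ((n / 2 : ℕ) : ℝ) ^ θ ≤ ((n : ℝ) / 2) ^ θ := by
            gcongr
            exact Nat.cast_div_le
        _ = r * (n : ℝ) ^ θ := by
          rw [div_rpow hn'.le (by norm_num), hr, rpow_neg (by norm_num)]
          ring
    have h4 : ((n / 2 + 1 : ℕ) : ℝ) ^ θ ≤ (n : ℝ) ^ θ := by
      gcongr
      omega
    rw [hsplit]
    calc _ ≤ C / (1 - r) * ((n / 2 : ℕ) : ℝ) ^ θ + C * ((n / 2 + 1 : ℕ) : ℝ) ^ θ :=
          (abs_add_le _ _).trans (add_le_add h1 h2)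
      _ ≤ C / (1 - r) * (r * (n : ℝ) ^ θ) + C * (n : ℝ) ^ θ := by gcongr
      _ = _ := by
        field_simp
        ring

theorem exists_norm_sum_addChar_rpow_le {α t σ : ℝ} (hα : ∀ j : ℕ, α ≠ j) (ht : 0 ≤ t)
    (hσ : σ = sSup {x : ℝ | ∃ m : ℕ, 2 ≤ m ∧
      x = min ((2 : ℝ) ^ ((1 : ℝ) - (m : ℝ)))
        (min (((m : ℝ) - α) / ((2 : ℝ) ^ m - 1)) ((2 : ℝ) ^ ((1 : ℝ) - (m : ℝ)) * α))})
    (htσ : t < σ) :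
    ∃ s B : ℝ, t < s ∧ s < 1 ∧ ∀ N L k : ℕ, 0 < N → L ≤ N → 0 < k →
      ‖∑ n ∈ Finset.range L, addChar (k * ((N : ℝ) + n) ^ α)‖ ≤
        B * (N * ((N : ℝ) ^ (-s) * max 1 (k * (N : ℝ) ^ (-s)))) := by
  classical
  have hpow : ∀ j : ℕ, (2 : ℝ) ^ ((1 : ℝ) - ((j + 1 : ℕ) : ℝ)) = 1 / 2 ^ j := fun j => by
    rw [← rpow_natCast 2 j, one_div, ← rpow_neg (by norm_num)]
    congr 1
    push_cast
    ring
  set μ : ℕ → ℝ := fun m => min ((2 : ℝ) ^ ((1 : ℝ) - (m : ℝ)))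
    (min (((m : ℝ) - α) / ((2 : ℝ) ^ m - 1)) ((2 : ℝ) ^ ((1 : ℝ) - (m : ℝ)) * α)) with hμ
  have hμj : ∀ (j : ℕ) (s : ℝ), s ≤ μ (j + 1 + 1) ↔
      s * 2 ^ (j + 1) ≤ 1 ∧ s * (2 * 2 ^ (j + 1) - 1) ≤ (j + 1 + 1 : ℕ) - α ∧
        s * 2 ^ (j + 1) ≤ α := by
    intro j s
    have h1 : (2 : ℝ) ≤ 2 ^ (j + 1) := by
      rw [pow_succ]
      linarith [one_le_pow₀ (by norm_num : (1 : ℝ) ≤ 2) (n := j)]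
    rw [hμ]
    simp only [le_min_iff]
    rw [hpow, le_div_iff₀ (by positivity), pow_succ _ (j + 1), mul_comm _ (2 : ℝ),
      le_div_iff₀ (by linarith), one_div_mul_eq_div, le_div_iff₀ (by positivity)]
  have hex : ∃ m : ℕ, 2 ≤ m ∧ t < μ m := by
    rw [hσ] at htσ
    obtain ⟨_, ⟨m, hm, rfl⟩, hlt⟩ := exists_lt_of_lt_csSup (by exact ⟨_, 2, le_rfl, rfl⟩) htσ
    exact ⟨m, hm, hlt⟩
  obtain ⟨hm2, htm⟩ := Nat.find_spec hex
  have hmin := fun j => Nat.find_min hex (m := j)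
  generalize Nat.find hex = m at hm2 htm hmin
  obtain ⟨j, rfl⟩ : ∃ j, m = j + 1 + 1 := ⟨m - 2, by omega⟩
  obtain ⟨h1, h2, h3⟩ := (hμj j _).1 le_rfl
  set s := μ (j + 1 + 1) with hs
  have hs0 : 0 < s := by linarith
  have h1' : (2 : ℝ) ≤ 2 ^ (j + 1) := by
    rw [pow_succ]
    linarith [one_le_pow₀ (by norm_num : (1 : ℝ) ≤ 2) (n := j)]
  have hs1 : s < 1 := by nlinarith
  have hαm : α < (j + 1 + 1 : ℕ) := by nlinarith
  rcases j with _ | q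
  · obtain ⟨B, -, hB⟩ := exists_norm_sum_addChar_rpow_le_of_two (σ := s) hα
      (by push_cast at hαm; linarith) (by push_cast at h2; linarith) (by norm_num at h3; linarith)
    exact ⟨s, B, htm, hs1, hB⟩
  · have hbd : ((q + 1 + 2 : ℕ) : ℝ) - α ≤ 2 - s := by
      by_contra hcon
      push Not at hcon
      refine hmin (q + 1 + 1) (by omega) ⟨by omega, htm.trans_le ((hμj q s).2 ⟨?_, ?_, ?_⟩)⟩
      · rw [pow_succ] at h1
        nlinarith [mul_pos hs0 (by positivity : (0 : ℝ) < 2 ^ (q + 1))]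
      · rw [pow_succ] at h1
        push_cast at hcon ⊢
        linarith
      · rw [pow_succ] at h3
        nlinarith [mul_pos hs0 (by positivity : (0 : ℝ) < 2 ^ (q + 1))]
    obtain ⟨B, -, hB⟩ := exists_norm_sum_addChar_rpow_le_of_three_le q hα hαm hs0
      (by rw [pow_succ] at h1; linarith) (by rw [pow_succ _ (q + 1)] at h2; linarith) hbd
    exact ⟨s, B, htm, hs1, hB⟩

theorem exists_abs_sum_Icc_fract_rpow_le {α t σ : ℝ} (hα : ∀ j : ℕ, α ≠ j) (ht : 0 < t)
    (hσ : σ = sSup {x : ℝ | ∃ m : ℕ, 2 ≤ m ∧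
      x = min ((2 : ℝ) ^ ((1 : ℝ) - (m : ℝ)))
        (min (((m : ℝ) - α) / ((2 : ℝ) ^ m - 1)) ((2 : ℝ) ^ ((1 : ℝ) - (m : ℝ)) * α))})
    (htσ : t < σ) :
    ∃ K : ℝ, 0 < K ∧ ∀ n : ℕ,
      |∑ k ∈ Finset.Icc 1 n, (Int.fract ((k : ℝ) ^ α) - 1 / 2)| ≤ K * (n : ℝ) ^ (1 - t) := by
  obtain ⟨s, B, hts, hs1, hB⟩ := exists_norm_sum_addChar_rpow_le hα ht.le hσ htσ
  have hs0 : 0 < s := ht.trans hts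
  have hlt : t / s < 1 := (div_lt_one hs0).2 hts
  have hpos : 0 < t / s := by positivity
  obtain ⟨C, hC, h⟩ := exists_abs_sum_fract_rpow_sub_half_le (η := (1 - t / s) / 2) hs0
    (by linarith) (by linarith) hB
  refine exists_abs_sum_Icc_le_of_dyadic (θ := 1 - t) hC (by linarith) fun N L hN hL => ?_
  have := h N L hN hL
  rw [show s * (1 - 2 * ((1 - t / s) / 2)) = t by field_simp; ring] at this
  simpa only [Nat.cast_add] using this

theorem mellin_sum_Icc_floor (f : ℕ → ℂ) (s : ℂ) :
    mellin (fun t => ∑ k ∈ Finset.Icc 1 ⌊t⌋₊, f k) (-s) =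
      ∫ t in Set.Ioi (1 : ℝ), (∑ k ∈ Finset.Icc 1 ⌊t⌋₊, f k) * (t : ℂ) ^ (-(s + 1)) := by
  rw [mellin, MeasureTheory.setIntegral_eq_of_subset_of_forall_sdiff_eq_zero
      (s := Set.Ici (1 : ℝ)) (t := Set.Ioi (0 : ℝ)) measurableSet_Ioi
      (fun t (ht : 1 ≤ t) => zero_lt_one.trans_le ht), MeasureTheory.integral_Ici_eq_integral_Ioi]
  · refine MeasureTheory.setIntegral_congr_fun measurableSet_Ioi fun t _ => ?_
    simp only [smul_eq_mul]
    rw [mul_comm, show -s - 1 = -(s + 1) by ring]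
  · rintro t ⟨-, ht⟩
    rw [Set.mem_Ici, not_le] at ht
    simp [Nat.floor_eq_zero.2 ht]

theorem norm_sum_Icc_floor_le {f : ℕ → ℂ} {K θ : ℝ} (hK : 0 < K) (hθ : 0 ≤ θ)
    (h : ∀ n : ℕ, ‖∑ k ∈ Finset.Icc 1 n, f k‖ ≤ K * (n : ℝ) ^ θ) {t : ℝ} (ht : 0 ≤ t) :
    ‖∑ k ∈ Finset.Icc 1 ⌊t⌋₊, f k‖ ≤ K * t ^ θ := by
  refine (h _).trans ?_
  gcongr
  exact Nat.floor_le ht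

theorem differentiableAt_mellin_sum_Icc_floor {f : ℕ → ℂ} {K θ : ℝ} (hK : 0 < K) (hθ : 0 ≤ θ)
    (h : ∀ n : ℕ, ‖∑ k ∈ Finset.Icc 1 n, f k‖ ≤ K * (n : ℝ) ^ θ) {s : ℂ} (hs : θ < s.re) :
    DifferentiableAt ℂ (mellin fun t => ∑ k ∈ Finset.Icc 1 ⌊t⌋₊, f k) (-s) := by
  refine mellin_differentiableAt_of_isBigO_rpow (a := -θ) (b := -s.re - 1) ?_ ?_ ?_ ?_ ?_
  · have := locallyIntegrableOn_mul_sum_Icc f (m := 1) (le_refl (0 : ℝ)) (g := fun _ => (1 : ℂ))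
      ((MeasureTheory.locallyIntegrable_const _).locallyIntegrableOn _)
    simp only [one_mul] at this
    exact this.mono_set Set.Ioi_subset_Ici_self
  · refine Asymptotics.IsBigO.of_bound K ?_
    filter_upwards [eventually_ge_atTop 0] with t ht
    rw [neg_neg, norm_of_nonneg (by positivity : 0 ≤ t ^ θ)]
    exact norm_sum_Icc_floor_le hK hθ h ht
  · simpa using hs
  · refine Asymptotics.IsBigO.of_bound 1 ?_
    filter_upwards [Ioo_mem_nhdsGT (zero_lt_one : (0 : ℝ) < 1)] with t ht
    simp only [Nat.floor_eq_zero.2 ht.2]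
    simp
  · simp

theorem norm_integral_sum_Icc_floor_le {f : ℕ → ℂ} {K θ : ℝ} (hK : 0 < K) (hθ : 0 ≤ θ)
    (h : ∀ n : ℕ, ‖∑ k ∈ Finset.Icc 1 n, f k‖ ≤ K * (n : ℝ) ^ θ) {s : ℂ} (hs : θ < s.re) :
    ‖∫ t in Set.Ioi (1 : ℝ), (∑ k ∈ Finset.Icc 1 ⌊t⌋₊, f k) * (t : ℂ) ^ (-(s + 1))‖ ≤
      K / (s.re - θ) := by
  have hlt : θ - s.re - 1 < -1 := by linarith
  have hint := integrableOn_Ioi_rpow_of_lt hlt zero_lt_one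
  refine (MeasureTheory.norm_integral_le_of_norm_le (hint.const_mul K)
    (MeasureTheory.ae_restrict_of_forall_mem measurableSet_Ioi fun t (ht : 1 < t) => ?_)).trans ?_
  · have ht0 : 0 < t := zero_lt_one.trans ht
    rw [norm_mul, Complex.norm_cpow_eq_rpow_re_of_pos ht0]
    calc _ ≤ K * t ^ θ * t ^ (-(s + 1)).re := by
          gcongr
          exact norm_sum_Icc_floor_le hK hθ h ht0.le
      _ = _ := by
        rw [mul_assoc, ← rpow_add ht0]
        congr 2
        simp
        ring
  · rw [MeasureTheory.integral_const_mul, integral_Ioi_rpow_of_lt hlt zero_lt_one, one_rpow,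
      show θ - s.re - 1 + 1 = -(s.re - θ) by ring, neg_div_neg_eq, mul_one_div]

theorem exists_analytic_continuation_of_norm_sum_le {f : ℕ → ℂ} {σ : ℝ} (hf : ∀ n, ‖f n‖ ≤ 1)
    (hσ : σ ∈ Set.Ioo (0 : ℝ) 1)
    (h : ∀ t, 0 < t → t < σ → ∃ K : ℝ, 0 < K ∧ ∀ n : ℕ,
      ‖∑ k ∈ Finset.Icc 1 n, f k‖ ≤ K * (n : ℝ) ^ (1 - t)) :
    ∃ F : ℂ → ℂ, DifferentiableOn ℂ F {s : ℂ | 1 - σ < s.re} ∧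
      (∀ s : ℂ, 1 < s.re → F s = LSeries f s) ∧
      ∀ ε > 0, ∃ C > 0, ∀ s : ℂ, 1 - σ + ε ≤ s.re → ‖F s‖ ≤ C * (1 + ‖s‖) := by
  obtain ⟨hσ0, hσ1⟩ := hσ
  refine ⟨fun s => s * mellin (fun t => ∑ k ∈ Finset.Icc 1 ⌊t⌋₊, f k) (-s), ?_, ?_, ?_⟩
  · intro s hs
    rw [Set.mem_ofPred_eq] at hs
    obtain ⟨t, ht, htσ⟩ := exists_between (max_lt (by linarith : 1 - s.re < σ) hσ0)
    rw [max_lt_iff] at ht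
    obtain ⟨K, hK, hKn⟩ := h t ht.2 htσ
    have hd := differentiableAt_mellin_sum_Icc_floor hK (by linarith) hKn
      (by linarith [ht.1] : 1 - t < s.re)
    exact (differentiableAt_id.mul (hd.comp s differentiableAt_id.neg)).differentiableWithinAt
  · intro s hs
    dsimp only
    rw [mellin_sum_Icc_floor]
    refine (LSeries_eq_mul_integral' f zero_le_one hs ?_).symm
    refine Asymptotics.IsBigO.of_bound 1 (Eventually.of_forall fun n => ?_)
    rw [rpow_one, one_mul, norm_of_nonneg (by positivity), norm_of_nonneg (by positivity)]
    exact (Finset.sum_le_sum fun k _ => hf k).trans (by simp)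
  · intro ε hε
    have hlt : max (σ - ε / 2) (σ / 2) < σ := max_lt (by linarith) (by linarith)
    obtain ⟨K, hK, hKn⟩ := h _ (lt_max_of_lt_right (by linarith)) hlt
    refine ⟨K / (ε / 2), by positivity, fun s hs => ?_⟩
    have hl := le_max_left (σ - ε / 2) (σ / 2)
    have hb := norm_integral_sum_Icc_floor_le hK (by linarith) hKn (s := s) (by linarith)
    dsimp only
    rw [mellin_sum_Icc_floor, norm_mul]
    calc _ ≤ ‖s‖ * (K / (ε / 2)) := by
          gcongr
          refine hb.trans ?_
          gcongr
          linarith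
      _ ≤ _ := by
        rw [mul_comm]
        gcongr
        linarith

theorem LSeries_eq_tsum_succ (f : ℕ → ℂ) {s : ℂ} (hs : LSeriesSummable f s) :
    LSeries f s = ∑' n : ℕ, f (n + 1) / ((n : ℂ) + 1) ^ s := by
  rw [LSeries, Summable.tsum_eq_zero_add hs, LSeries.term_zero, zero_add]
  refine tsum_congr fun n => ?_
  rw [LSeries.term_of_ne_zero n.succ_ne_zero]
  push_cast
  rfl

theorem stmt16 (α : ℝ) (hα : 0 < α) (hαn : ∀ j : ℕ, α ≠ (j : ℝ)) (σ : ℝ)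
    (hσ : σ = sSup {x : ℝ | ∃ m : ℕ, 2 ≤ m ∧
      x = min ((2 : ℝ) ^ ((1 : ℝ) - (m : ℝ)))
        (min (((m : ℝ) - α) / ((2 : ℝ) ^ m - 1)) ((2 : ℝ) ^ ((1 : ℝ) - (m : ℝ)) * α))})
    (hσ' : σ ∈ Set.Ioo (0 : ℝ) 1) :
    ∃ f : ℂ → ℂ, DifferentiableOn ℂ f {s : ℂ | 1 - σ < s.re} ∧
      (∀ s : ℂ, 1 < s.re →
        f s = ∑' n : ℕ, ((Int.fract (((n : ℝ) + 1) ^ α) - 1 / 2 : ℝ) : ℂ) / ((n : ℂ) + 1) ^ s) ∧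
      ∀ ε > 0, ∃ C > 0, ∀ s : ℂ, 1 - σ + ε ≤ s.re → ‖f s‖ ≤ C * (1 + ‖s‖) := by
  have hbd : ∀ n : ℕ, ‖((Int.fract ((n : ℝ) ^ α) - 1 / 2 : ℝ) : ℂ)‖ ≤ 1 := fun n => by
    rw [Complex.norm_real, norm_eq_abs, abs_le]
    constructor <;>
      linarith [Int.fract_nonneg ((n : ℝ) ^ α), Int.fract_lt_one ((n : ℝ) ^ α)]
  obtain ⟨F, hF, hFs, hFb⟩ := exists_analytic_continuation_of_norm_sum_le hbd hσ'
    fun t ht htσ => by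
      obtain ⟨K, hK, hKn⟩ := exists_abs_sum_Icc_fract_rpow_le hαn ht hσ htσ
      refine ⟨K, hK, fun n => ?_⟩
      rw [← Complex.ofReal_sum, Complex.norm_real, norm_eq_abs]
      exact hKn n
  refine ⟨F, hF, fun s hs => ?_, hFb⟩
  rw [hFs s hs, LSeries_eq_tsum_succ]
  · push_cast
    rfl
  · exact LSeriesSummable_of_bounded_of_one_lt_re (fun n _ => hbd n) hs
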